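/- arXiv:math/0608287 — 2 statements merged into one kernel-verified Lean document; each statement's English description precedes it below -/
import Mathlib

section
/- Any two nodal roots of Λ are equivalent under Γ: if r and s are roots of Λ with {⟨r,x⟩ : x ∈ Λ} = θℰ and {⟨s,x⟩ : x ∈ Λ} = θℰ, then there exists γ ∈ Γ with γ(r) = s. -/
noncomputable section

/-- The primitive cube root of unity `ω = e^{2πi/3}`. -/
def ω : ℂ := ⟨-1/2, Real.sqrt 3 / 2⟩

/-- `θ = ω - ω̄`, a square root of `-3`. -/
def θ : ℂ := ω - (starRingEnd ℂ) ω

/-- The ring of Eisenstein integers `ℰ = ℤ[ω]` as a subring of ℂ. -/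
def Eis : Subring ℂ := Subring.closure {ω}

/-- The Gram matrix of `E₈^ℰ`. -/
def Bmat : Matrix (Fin 4) (Fin 4) ℂ :=
  !![3, θ, 0, 0; -θ, 3, θ, 0; 0, -θ, 3, θ; 0, 0, -θ, 3]

/-- The Gram matrix of the hyperbolic cell `H`. -/
def Cmat : Matrix (Fin 2) (Fin 2) ℂ := !![0, θ; -θ, 0]

/-- The Gram matrix of `Λ₁₀`: block diagonal with blocks B, B, C. -/
def Lam10 : Matrix (Fin 10) (Fin 10) ℂ := Matrix.of fun i j =>
  if h : i.val < 4 ∧ j.val < 4 then Bmat ⟨i.val, h.1⟩ ⟨j.val, h.2⟩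
  else if h : 4 ≤ i.val ∧ i.val < 8 ∧ 4 ≤ j.val ∧ j.val < 8 then
    Bmat ⟨i.val - 4, by omega⟩ ⟨j.val - 4, by omega⟩
  else if h : 8 ≤ i.val ∧ 8 ≤ j.val then
    Cmat ⟨i.val - 8, by have := i.isLt; omega⟩ ⟨j.val - 8, by have := j.isLt; omega⟩
  else 0

/-- The Gram matrix of `Λ = (3) ⊕ Λ₁₀`: block diagonal with blocks (3), B, B, C. -/
def Lam11 : Matrix (Fin 11) (Fin 11) ℂ := Matrix.of fun i j =>
  if i.val = 0 ∧ j.val = 0 then 3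
  else if h : 1 ≤ i.val ∧ 1 ≤ j.val then
    Lam10 ⟨i.val - 1, by have := i.isLt; omega⟩ ⟨j.val - 1, by have := j.isLt; omega⟩
  else 0

/-- The Hermitian form of `Λ = ℰ¹¹`. -/
def hermE (x y : Fin 11 → Eis) : ℂ :=
  ∑ i : Fin 11, ∑ j : Fin 11, Lam11 i j * (x i : ℂ) * (starRingEnd ℂ) ((y j : ℂ))

/-- The ideal `θℰ ⊆ ℂ`. -/
def thetaEis : Set ℂ := {z | ∃ e : Eis, z = θ * (e : ℂ)}

/-- The ideal `3ℰ ⊆ ℂ`. -/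
def threeEis : Set ℂ := {z | ∃ e : Eis, z = 3 * (e : ℂ)}

/-- The set `{⟨r,x⟩ : x ∈ Λ}`. -/
def innerSetE (r : Fin 11 → Eis) : Set ℂ := {c | ∃ x : Fin 11 → Eis, c = hermE r x}

/-- A computable model `ℤ[X]/(X² + X + 1)` of the Eisenstein integers. -/
abbrev EisInt : Type := QuadraticAlgebra ℤ (-1) (-1)

namespace EisInt

/-- The square root `1 + 2ω` of `-3`. -/
def th : EisInt := ⟨1, 2⟩

theorem star_re (z : EisInt) : (star z).re = z.re - z.im := by
  simp [sub_eq_add_neg]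

theorem star_im (z : EisInt) : (star z).im = -z.im := by
  simp

theorem norm_nonneg (z : EisInt) : 0 ≤ z.norm := by
  rw [QuadraticAlgebra.norm_def]
  nlinarith [sq_nonneg (2 * z.re - z.im), sq_nonneg z.im]

theorem norm_eq_zero {z : EisInt} (h : z.norm = 0) : z = 0 := by
  rw [QuadraticAlgebra.norm_def] at h
  have him : z.im = 0 := by
    have : z.im ^ 2 = 0 := by nlinarith [sq_nonneg (2 * z.re - z.im), sq_nonneg z.im]
    simpa using this
  have hre : z.re = 0 := by
    rw [him] at h
    have : z.re ^ 2 = 0 := by nlinarith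
    simpa using this
  ext <;> simp [him, hre]

theorem norm_pos {z : EisInt} (h : z ≠ 0) : 0 < z.norm :=
  lt_of_le_of_ne (norm_nonneg z) fun h' => h (norm_eq_zero h'.symm)

theorem mul_star_self (z : EisInt) : z * star z = (z.norm : EisInt) := by
  ext <;> simp [QuadraticAlgebra.norm_def] <;> ring

instance : NoZeroDivisors EisInt where
  eq_zero_or_eq_zero_of_mul_eq_zero {x y} h := by
    have h1 : x.norm * y.norm = 0 := by rw [← map_mul, h]; simp
    rcases mul_eq_zero.1 h1 with h2 | h2
    · exact Or.inl (norm_eq_zero h2)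
    · exact Or.inr (norm_eq_zero h2)

instance : IsDomain EisInt := NoZeroDivisors.to_isDomain _

/-- Division with rounding of the coordinates. -/
def quot (x y : EisInt) : EisInt :=
  ⟨round ((x * star y).re / y.norm : ℚ), round ((x * star y).im / y.norm : ℚ)⟩

theorem norm_sub_mul_quot_lt (x : EisInt) {y : EisInt} (hy : y ≠ 0) :
    (x - y * quot x y).norm < y.norm := by
  have hn : (0 : ℚ) < y.norm := by exact_mod_cast norm_pos hy
  set a := (x * star y).re with ha
  set b := (x * star y).im with hb
  have h1 := abs_sub_round ((a : ℚ) / y.norm)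
  have h2 := abs_sub_round ((b : ℚ) / y.norm)
  have hq : quot x y = ⟨round ((a : ℚ) / y.norm), round ((b : ℚ) / y.norm)⟩ := rfl
  set u := round ((a : ℚ) / y.norm)
  set v := round ((b : ℚ) / y.norm)
  have key : (x - y * quot x y).norm * y.norm
      = (a - y.norm * u) ^ 2 - (a - y.norm * u) * (b - y.norm * v) + (b - y.norm * v) ^ 2 := by
    rw [hq, ← QuadraticAlgebra.norm_star y, ← map_mul]
    have : (x - y * ⟨u, v⟩) * star y = ⟨a - y.norm * u, b - y.norm * v⟩ := by
      ext <;> simp [ha, hb, QuadraticAlgebra.norm_def] <;> ring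
    rw [this, QuadraticAlgebra.norm_star]
    simp only [QuadraticAlgebra.norm_def]
    ring
  have key' : ((x - y * quot x y).norm : ℚ) * y.norm
      = y.norm ^ 2 * ((a / y.norm - u) ^ 2 - (a / y.norm - u) * (b / y.norm - v)
        + (b / y.norm - v) ^ 2) := by
    have : ((x - y * quot x y).norm : ℚ) * y.norm
      = (a - y.norm * u) ^ 2 - (a - y.norm * u) * (b - y.norm * v) + (b - y.norm * v) ^ 2 := by
      exact_mod_cast key
    rw [this]
    field_simp
  have hlt : ((a : ℚ) / y.norm - u) ^ 2 - (a / y.norm - u) * (b / y.norm - v)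
        + (b / y.norm - v) ^ 2 < 1 := by
    rw [abs_le] at h1 h2
    nlinarith [mul_nonneg (sub_nonneg.2 h1.1) (sub_nonneg.2 h1.2),
      mul_nonneg (sub_nonneg.2 h2.1) (sub_nonneg.2 h2.2),
      sq_nonneg (((a : ℚ) / y.norm - u) + (b / y.norm - v))]
  have : ((x - y * quot x y).norm : ℚ) * y.norm < y.norm * y.norm := by
    rw [key', sq]
    exact mul_lt_of_lt_one_right (by positivity) hlt
  exact_mod_cast lt_of_mul_lt_mul_right this hn.le

instance : EuclideanDomain EisInt where
  quotient := quot
  remainder x y := x - y * quot x y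
  quotient_zero x := by ext <;> simp [quot]
  quotient_mul_add_remainder_eq x y := by ring
  r := fun x y => x.norm.toNat < y.norm.toNat
  r_wellFounded := (measure fun x : EisInt => x.norm.toNat).wf
  remainder_lt x y hy := by
    have h1 := norm_sub_mul_quot_lt x hy
    have h2 := norm_nonneg (x - y * quot x y)
    omega
  mul_left_not_lt x y hy := by
    have h1 := norm_pos hy
    have h2 := norm_nonneg x
    rw [map_mul]
    have : x.norm ≤ x.norm * y.norm := by nlinarith
    omega

instance : IsPrincipalIdealRing EisInt := inferInstance

theorem star_th : star th = -th := by decide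

theorem th_mul_th : th * th = -3 := by decide

theorem th_ne_zero : th ≠ 0 := by decide

theorem three_ne_zero : (3 : EisInt) ≠ 0 := by decide

/-- Reduction modulo `θ`. -/
def red : EisInt →+* ZMod 3 where
  toFun z := z.re + z.im
  map_one' := by decide
  map_mul' x y := by
    have : (3 : ZMod 3) = 0 := by decide
    simp only [QuadraticAlgebra.re_mul, QuadraticAlgebra.im_mul]
    push_cast
    linear_combination (-(x.im : ZMod 3) * y.im) * this
  map_zero' := by decide
  map_add' x y := by simp; ring

theorem red_star (z : EisInt) : red (star z) = red z := by
  have : (3 : ZMod 3) = 0 := by decide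
  change ((star z).re + (star z).im : ZMod 3) = z.re + z.im
  rw [star_re, star_im]
  push_cast
  linear_combination -(z.im : ZMod 3) * this

theorem red_th : red th = 0 := by decide

theorem red_eq_zero_iff {z : EisInt} : red z = 0 ↔ th ∣ z := by
  constructor
  · intro h
    have h' : ((z.re + z.im : ℤ) : ZMod 3) = 0 := by
      rw [Int.cast_add]; exact h
    obtain ⟨k, hk⟩ := (ZMod.intCast_zmod_eq_zero_iff_dvd _ _).1 h'
    push_cast at hk
    refine ⟨⟨z.im - k, z.im - 2 * k⟩, ?_⟩
    ext <;> simp [th] <;> linarith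
  · rintro ⟨c, rfl⟩
    rw [map_mul, red_th, zero_mul]

theorem red_surjective : Function.Surjective red := fun a =>
  ⟨(a.val : EisInt), by simp⟩

instance : RingHomSurjective red := ⟨red_surjective⟩

theorem exists_int_of_star_eq {z : EisInt} (h : star z = z) : ∃ n : ℤ, z = n := by
  have h1 := congrArg QuadraticAlgebra.im h
  rw [star_im] at h1
  exact ⟨z.re, by ext <;> simp; omega⟩

theorem three_dvd_of_star_eq {z : EisInt} (h : star z = z) (h' : th ∣ z) : (3 : EisInt) ∣ z := by
  obtain ⟨n, rfl⟩ := exists_int_of_star_eq h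
  rw [← red_eq_zero_iff, map_intCast] at h'
  obtain ⟨k, rfl⟩ := (ZMod.intCast_zmod_eq_zero_iff_dvd _ _).1 h'
  exact ⟨k, by push_cast; ring⟩

theorem exists_add_star_eq (n : ℤ) : ∃ c : EisInt, c + star c = n :=
  ⟨⟨0, -n⟩, by ext <;> simp⟩

theorem eq_neg_one_of_isUnit {z c a : EisInt} (hz : IsUnit z) (h : star z = z) (ha : a ≠ 0)
    (hc : c * star c * z = -(a * star a)) : z = -1 := by
  obtain ⟨n, rfl⟩ := exists_int_of_star_eq h
  rw [mul_star_self, mul_star_self] at hc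
  have hc' : c.norm * n = -a.norm := by exact_mod_cast hc
  have hu : n = 1 ∨ n = -1 := by
    have := (QuadraticAlgebra.isUnit_iff_norm_isUnit.1 hz)
    rw [QuadraticAlgebra.norm_intCast, isUnit_pow_iff two_ne_zero] at this
    exact Int.isUnit_iff.1 this
  rcases hu with rfl | rfl
  · have := norm_nonneg c
    have := norm_pos ha
    omega
  · simp

end EisInt

/-- A Hermitian form over the Eisenstein integers, linear in the first variable. -/
structure HermForm (U : Type*) [AddCommGroup U] [Module EisInt U] where
  /-- The underlying function. -/
  toFun : U → U → EisInt
  add_left' : ∀ x y z, toFun (x + y) z = toFun x z + toFun y z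
  smul_left' : ∀ (c : EisInt) x y, toFun (c • x) y = c * toFun x y
  star_apply' : ∀ x y, star (toFun x y) = toFun y x

namespace HermForm

variable {U : Type*} [AddCommGroup U] [Module EisInt U]

instance : CoeFun (HermForm U) fun _ => U → U → EisInt := ⟨toFun⟩

variable (h : HermForm U)

theorem add_left (x y z : U) : h (x + y) z = h x z + h y z := h.add_left' x y z

theorem smul_left (c : EisInt) (x y : U) : h (c • x) y = c * h x y := h.smul_left' c x y

theorem star_apply (x y : U) : star (h x y) = h y x := h.star_apply' x y

theorem add_right (x y z : U) : h x (y + z) = h x y + h x z := by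
  rw [← h.star_apply, h.add_left, star_add, h.star_apply, h.star_apply]

theorem smul_right (c : EisInt) (x y : U) : h x (c • y) = star c * h x y := by
  rw [← h.star_apply, h.smul_left, star_mul', h.star_apply]

/-- The linear functional pairing with a fixed second argument. -/
def pairing (y : U) : U →ₗ[EisInt] EisInt where
  toFun x := h x y
  map_add' a b := h.add_left a b y
  map_smul' c a := h.smul_left c a y

theorem pairing_apply (x y : U) : h.pairing y x = h x y := rfl

theorem sub_left (x y z : U) : h (x - y) z = h x z - h y z := map_sub (h.pairing z) x y

theorem zero_left (y : U) : h 0 y = 0 := map_zero (h.pairing y)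

theorem sum_left {ι : Type*} (s : Finset ι) (f : ι → U) (y : U) :
    h (∑ i ∈ s, f i) y = ∑ i ∈ s, h (f i) y := map_sum (h.pairing y) f s

theorem sub_right (x y z : U) : h x (y - z) = h x y - h x z := by
  rw [← h.star_apply, h.sub_left, star_sub, h.star_apply, h.star_apply]

theorem sum_right {ι : Type*} (s : Finset ι) (f : ι → U) (x : U) :
    h x (∑ i ∈ s, f i) = ∑ i ∈ s, h x (f i) := by
  rw [← h.star_apply, h.sum_left, star_sum]
  simp only [h.star_apply]

theorem apply_eq_zero_comm {x y : U} (hxy : h x y = 0) : h y x = 0 := by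
  rw [← h.star_apply, hxy, star_zero]

/-- The restriction of a Hermitian form to a submodule. -/
def restrict (W : Submodule EisInt U) : HermForm W where
  toFun x y := h x y
  add_left' x y z := h.add_left x y z
  smul_left' c x y := h.smul_left c x y
  star_apply' x y := h.star_apply x y

theorem restrict_apply (W : Submodule EisInt U) (x y : W) : h.restrict W x y = h x y := rfl

/-- Every linear functional is represented by a vector. -/
def IsUnimodular : Prop :=
  ∀ φ : U →ₗ[EisInt] EisInt, ∃ u, ∀ x, φ x = h x u

/-- The orthogonal complement of a vector. -/
def perp (v : U) : Submodule EisInt U := LinearMap.ker (h.pairing v)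

theorem mem_perp {v x : U} : x ∈ h.perp v ↔ h x v = 0 := LinearMap.mem_ker

/-- An orthogonal family, with norms `s i * (a * star a)`, whose orthogonal complement vanishes. -/
structure IsFrame {n : ℕ} (s : Fin n → EisInt) (a : EisInt) (f : Fin n → U) : Prop where
  apply_eq : ∀ i j, h (f i) (f j) = if i = j then s i * (a * star a) else 0
  complete : ∀ x, (∀ i, h x (f i) = 0) → x = 0

variable {h}

namespace IsFrame

variable {n : ℕ} {s : Fin n → EisInt} {a : EisInt} {f : Fin n → U}

theorem eq_zero_of_forall (hf : h.IsFrame s a f) {x : U} (hx : ∀ y, h y x = 0) : x = 0 :=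
  hf.complete x fun i => h.apply_eq_zero_comm (hx (f i))

theorem eq_zero_of_smul (hf : h.IsFrame s a f) {c : EisInt} {x : U} (hc : c ≠ 0)
    (hx : c • x = 0) : x = 0 := by
  refine hf.complete x fun i => ?_
  have := h.smul_left c x (f i)
  rw [hx, h.zero_left] at this
  exact (mul_eq_zero.1 this.symm).resolve_left hc

/-- Expansion of a vector in an orthonormal frame. -/
theorem sum_eq (hf : h.IsFrame s 1 f) (hs : ∀ i, s i * s i = 1) (x : U) :
    ∑ i, (s i * h x (f i)) • f i = x := by
  refine sub_eq_zero.1 (hf.complete _ fun j => ?_)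
  rw [h.sub_left, h.sum_left]
  simp only [h.smul_left, hf.apply_eq]
  simp only [star_one, mul_one, mul_ite, mul_zero, Finset.sum_ite_eq', Finset.mem_univ, if_true]
  linear_combination h x (f j) * hs j

end IsFrame

/-- A Witt cancellation step: a frame whose first norm is that of a multiple of `v` can be carried
to the orthogonal complement of `v`. -/
theorem IsFrame.exists_perp {n : ℕ} {s : Fin n → EisInt} {a : EisInt} (ha : a ≠ 0)
    {f : Fin (n + 1) → U} (hf : h.IsFrame (Fin.cons 1 s : Fin (n + 1) → EisInt) a f) {v : U}
    (hv : h v v = 1) :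
    ∃ b ≠ 0, ∃ f' : Fin n → h.perp v, (h.restrict (h.perp v)).IsFrame s b f' := by
  have h00 : h (f 0) (f 0) = a * star a := by simpa using hf.apply_eq 0 0
  have hna : a * star a ≠ 0 := mul_ne_zero ha (by simpa using ha)
  obtain ⟨ζ, hζ, hζs, hp⟩ : ∃ ζ : EisInt, ζ * ζ = 1 ∧ star ζ = ζ ∧
      h (f 0) (f 0 - (ζ * a) • v) ≠ 0 := by
    by_contra! hcon
    have h1 := hcon 1 (by simp) (by simp)
    have h2 := hcon (-1) (by simp) (by simp)
    rw [h.sub_right, h.smul_right, h00] at h1 h2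
    simp only [star_mul', star_one, star_neg] at h1 h2
    have : (2 : EisInt) * (a * star a) = 0 := by linear_combination h1 + h2
    exact mul_ne_zero two_ne_zero hna this
  set w := (ζ * a) • v with hw
  set δ := f 0 - w with hδ
  set p := h (f 0) δ with hpdef
  have hww : h w w = a * star a := by
    rw [hw, h.smul_left, h.smul_right, hv, star_mul', hζs]
    linear_combination (a * star a) * hζ
  have hδδ : h δ δ = p + star p := by
    have h1 : p = a * star a - h (f 0) w := by rw [hpdef, hδ, h.sub_right, h00]
    rw [h1, star_sub, h.star_apply, star_mul', star_star, hδ, h.sub_left, h.sub_right, h.sub_right,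
      h00, hww]
    ring
  let R : U → U := fun x => p • x - h x δ • δ
  have hR : ∀ x y, h (R x) (R y) = p * star p * h x y := by
    intro x y
    simp only [R, h.sub_left, h.sub_right, h.smul_left, h.smul_right, hδδ]
    rw [h.star_apply y δ]
    ring
  have hR0 : R (f 0) = (p * (ζ * a)) • v := by
    simp only [R]
    rw [← hpdef, hδ, hw, smul_sub, sub_sub_cancel, smul_smul]
  have hζ0 : ζ ≠ 0 := by rintro rfl; simp at hζ
  have hc0 : star (p * (ζ * a)) ≠ 0 := by
    rw [Ne, star_eq_zero]
    exact mul_ne_zero hp (mul_ne_zero hζ0 ha)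
  have hmem : ∀ i : Fin n, R (f i.succ) ∈ h.perp v := by
    intro i
    have h1 := hR (f i.succ) (f 0)
    rw [hR0, h.smul_right, hf.apply_eq, if_neg (Fin.succ_ne_zero i), mul_zero] at h1
    exact h.mem_perp.2 ((mul_eq_zero.1 h1).resolve_left hc0)
  have hadj : ∀ x y, h x (R y) = h (star p • x - h x δ • δ) y := by
    intro x y
    simp only [R, h.sub_left, h.sub_right, h.smul_left, h.smul_right]
    rw [h.star_apply y δ]
    ring
  refine ⟨p * a, mul_ne_zero hp ha, fun i => ⟨R (f i.succ), hmem i⟩, ⟨?_, ?_⟩⟩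
  · intro i j
    rw [h.restrict_apply]
    change h (R (f i.succ)) (R (f j.succ)) = _
    rw [hR, hf.apply_eq]
    simp only [Fin.succ_inj, Fin.cons_succ, star_mul']
    split_ifs
    · ring
    · ring
  · rintro ⟨x, hx⟩ hxf
    have h1 : ∀ i, h x (R (f i)) = 0 := by
      intro i
      refine Fin.cases ?_ (fun j => hxf j) i
      rw [hR0, h.smul_right, h.mem_perp.1 hx, mul_zero]
    have h2 : star p • x - h x δ • δ = 0 := hf.complete _ fun i => by rw [← hadj, h1]
    have h3 : h (star p • x - h x δ • δ) δ = 0 := by rw [h2, h.zero_left]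
    rw [h.sub_left, h.smul_left, h.smul_left, hδδ] at h3
    have h4 : h x δ = 0 := by
      have : h x δ * p = 0 := by linear_combination -h3
      exact (mul_eq_zero.1 this).resolve_right hp
    rw [h4, zero_smul, sub_zero] at h2
    exact Subtype.ext (hf.eq_zero_of_smul (by simpa using hp) h2)

theorem IsUnimodular.perp (hU : h.IsUnimodular) {v : U} (hv : h v v = 1) :
    (h.restrict (h.perp v)).IsUnimodular := by
  intro φ
  have hmem : ∀ x, x - h x v • v ∈ h.perp v := fun x => by
    rw [h.mem_perp, h.sub_left, h.smul_left, hv]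
    ring
  let P : U →ₗ[EisInt] h.perp v :=
    LinearMap.codRestrict _ (LinearMap.id - (h.pairing v).smulRight v) hmem
  have hP : ∀ x (hx : x ∈ h.perp v), P x = ⟨x, hx⟩ := fun x hx => Subtype.ext <| by
    change x - h x v • v = x
    rw [h.mem_perp.1 hx, zero_smul, sub_zero]
  obtain ⟨u, hu⟩ := hU (φ ∘ₗ P)
  refine ⟨P u, fun x => ?_⟩
  have h1 := hu x
  rw [LinearMap.comp_apply, hP x x.2] at h1
  rw [h.restrict_apply]
  change _ = h x (u - h u v • v)
  rw [h.sub_right, h.smul_right, h.mem_perp.1 x.2, mul_zero, sub_zero, ← h1]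

/-- The signature `(n, 1)`. -/
def sgn : (n : ℕ) → Fin (n + 1) → EisInt
  | 0 => fun _ => -1
  | n + 1 => Fin.cons 1 (sgn n)

theorem sgn_last (n : ℕ) : sgn n (Fin.last n) = -1 := by
  induction n with
  | zero => rfl
  | succ n ih => rw [← Fin.succ_last, sgn, Fin.cons_succ, ih]

theorem sgn_castSucc (n : ℕ) (i : Fin n) : sgn n i.castSucc = 1 := by
  induction n with
  | zero => exact i.elim0
  | succ n ih =>
    refine Fin.cases rfl (fun j => ?_) i
    rw [← Fin.succ_castSucc, sgn, Fin.cons_succ, ih]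

theorem sgn_mul_self (n : ℕ) (i : Fin (n + 1)) : sgn n i * sgn n i = 1 := by
  refine Fin.lastCases ?_ (fun j => ?_) i
  · rw [sgn_last]; ring
  · rw [sgn_castSucc]; ring

theorem star_sgn (n : ℕ) (i : Fin (n + 1)) : star (sgn n i) = sgn n i := by
  refine Fin.lastCases ?_ (fun j => ?_) i
  · rw [sgn_last, star_neg, star_one]
  · rw [sgn_castSucc, star_one]

theorem IsUnimodular.exists_frame_of_rank_one (hU : h.IsUnimodular) {a : EisInt} (ha : a ≠ 0)
    {f : Fin 1 → U} (hf : h.IsFrame (sgn 0) a f) : ∃ e : Fin 1 → U, h.IsFrame (sgn 0) 1 e := by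
  have hff : h (f 0) (f 0) = -(a * star a) := by simpa [sgn] using hf.apply_eq 0 0
  obtain ⟨d, hd⟩ := (IsPrincipalIdealRing.principal (LinearMap.range (h.pairing (f 0)))).principal
  obtain ⟨e, he⟩ : d ∈ LinearMap.range (h.pairing (f 0)) := by
    rw [hd]; exact Submodule.mem_span_singleton_self d
  have hgen : ∀ x, ∃ c : EisInt, x = c • e := fun x => by
    have hx : h x (f 0) ∈ LinearMap.range (h.pairing (f 0)) := ⟨x, rfl⟩
    rw [hd, Submodule.mem_span_singleton] at hx
    obtain ⟨c, hc⟩ := hx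
    refine ⟨c, sub_eq_zero.1 (hf.complete _ fun i => ?_)⟩
    rw [Subsingleton.elim (α := Fin 1) i 0, h.sub_left, h.smul_left, ← hc, ← he,
      h.pairing_apply, smul_eq_mul, sub_self]
  obtain ⟨c, hc⟩ := hgen (f 0)
  have he0 : e ≠ 0 := by
    rintro rfl
    rw [hc, smul_zero, h.zero_left] at hff
    have hna : a * star a ≠ 0 := mul_ne_zero ha (by simpa using ha)
    exact hna (neg_eq_zero.1 hff.symm)
  have hli : ∀ c : EisInt, c • e = 0 → c = 0 := fun c hc => by
    by_contra hc0
    exact he0 (hf.eq_zero_of_smul hc0 hc)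
  have hinj : Function.Injective (LinearMap.toSpanSingleton EisInt U e) := by
    rw [← LinearMap.ker_eq_bot, LinearMap.ker_eq_bot']
    exact hli
  let E := LinearEquiv.ofBijective (LinearMap.toSpanSingleton EisInt U e)
    ⟨hinj, fun x => (hgen x).imp fun c hc => hc.symm⟩
  obtain ⟨u, hu⟩ := hU E.symm.toLinearMap
  have hE1 : E 1 = e := one_smul _ e
  have h1 : h e u = 1 := by
    rw [← hu e, ← hE1]
    exact E.symm_apply_apply 1
  obtain ⟨c', hc'⟩ := hgen u
  rw [hc', h.smul_right] at h1
  rw [hc, h.smul_left, h.smul_right, ← mul_assoc] at hff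
  have hee : h e e = -1 :=
    EisInt.eq_neg_one_of_isUnit (IsUnit.of_mul_eq_one_right _ h1) (h.star_apply e e) ha hff
  refine ⟨fun _ => e, ⟨fun i j => ?_, fun x hx => ?_⟩⟩
  · rw [if_pos (Subsingleton.elim (α := Fin 1) i j), hee]
    simp [sgn]
  · obtain ⟨k, rfl⟩ := hgen x
    have := hx 0
    rw [h.smul_left, hee] at this
    rw [show k = 0 by linear_combination -this, zero_smul]

/-- An indefinite unimodular lattice with a rational orthogonal frame has a vector of norm `1`. -/
theorem IsUnimodular.exists_norm_one (hU : h.IsUnimodular) {n : ℕ} {a : EisInt} (ha : a ≠ 0)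
    {f : Fin (n + 2) → U} (hf : h.IsFrame (sgn (n + 1)) a f) : ∃ v, h v v = 1 := by
  have hna : a * star a ≠ 0 := mul_ne_zero ha (by simpa using ha)
  have h0l : (0 : Fin (n + 2)) ≠ Fin.last (n + 1) := (Fin.last_pos).ne
  set ν := f 0 + f (Fin.last (n + 1)) with hν
  have hνν : h ν ν = 0 := by
    simp only [hν, h.add_left, h.add_right, hf.apply_eq, if_true, if_neg h0l, if_neg h0l.symm,
      sgn_last]
    rw [show sgn (n + 1) 0 = 1 from rfl]
    ring
  have hν0 : h (f 0) ν = a * star a := by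
    simp only [hν, h.add_right, hf.apply_eq, if_true, if_neg h0l]
    rw [show sgn (n + 1) 0 = 1 from rfl]
    ring
  obtain ⟨d, hd⟩ := (IsPrincipalIdealRing.principal (LinearMap.range (h.pairing ν))).principal
  obtain ⟨σ, hσ⟩ : d ∈ LinearMap.range (h.pairing ν) := by
    rw [hd]; exact Submodule.mem_span_singleton_self d
  have hdvd : ∀ x, d ∣ h x ν := fun x => by
    have hx : h x ν ∈ LinearMap.range (h.pairing ν) := ⟨x, rfl⟩
    rw [hd, Submodule.mem_span_singleton] at hx
    obtain ⟨c, hc⟩ := hx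
    exact ⟨c, by rw [← hc, smul_eq_mul, mul_comm]⟩
  have hd0 : d ≠ 0 := by
    rintro rfl
    exact hna (hν0 ▸ zero_dvd_iff.1 (hdvd (f 0)))
  choose q hq using hdvd
  let φ : U →ₗ[EisInt] EisInt :=
    { toFun := q
      map_add' := fun x y => mul_left_cancel₀ hd0 <| by
        rw [← hq, h.add_left, hq x, hq y]; ring
      map_smul' := fun c x => mul_left_cancel₀ hd0 <| by
        rw [← hq, h.smul_left, hq x, RingHom.id_apply, smul_eq_mul]; ring }
  obtain ⟨ρ, hρ⟩ := hU φ
  have hρν : ν = star d • ρ := by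
    refine sub_eq_zero.1 (hf.eq_zero_of_forall fun y => ?_)
    rw [h.sub_right, h.smul_right, star_star, ← hρ, hq y]
    exact sub_self _
  have hρρ : h ρ ρ = 0 := by
    rw [hρν, h.smul_left, h.smul_right, star_star] at hνν
    exact ((mul_eq_zero.1 ((mul_eq_zero.1 hνν).resolve_left (by simpa using hd0))).resolve_left hd0)
  have hσρ : h σ ρ = 1 := by
    rw [← hρ]
    refine mul_left_cancel₀ hd0 ?_
    change d * q σ = _
    rw [← hq, mul_one]
    exact hσ
  have hρσ : h ρ σ = 1 := by rw [← h.star_apply, hσρ, star_one]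
  obtain ⟨m, hm⟩ := EisInt.exists_int_of_star_eq (h.star_apply σ σ)
  obtain ⟨c, hc⟩ := EisInt.exists_add_star_eq (1 - m)
  refine ⟨σ + c • ρ, ?_⟩
  rw [h.add_left, h.add_right, h.add_right, h.smul_left, h.smul_left, h.smul_right, h.smul_right,
    hρρ, hσρ, hρσ, hm]
  push_cast at hc
  linear_combination hc

theorem IsFrame.cons {n : ℕ} {s : Fin n → EisInt} {v : U} (hv : h v v = 1)
    {f : Fin n → h.perp v} (hf : (h.restrict (h.perp v)).IsFrame s 1 f) :
    h.IsFrame (Fin.cons 1 s : Fin (n + 1) → EisInt) 1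
      (Fin.cons v fun i => (f i : U) : Fin (n + 1) → U) := by
  refine ⟨fun i j => ?_, fun x hx => ?_⟩
  · refine Fin.cases ?_ (fun i => ?_) i <;> refine Fin.cases ?_ (fun j => ?_) j
    · simp [hv]
    · have : h v (f j) = 0 := h.apply_eq_zero_comm (h.mem_perp.1 (f j).2)
      simp [this, (Fin.succ_ne_zero j).symm]
    · have : h (f i) v = 0 := h.mem_perp.1 (f i).2
      simp [this]
    · have := hf.apply_eq i j
      rw [h.restrict_apply] at this
      simpa using this
  · have hxv : x ∈ h.perp v := h.mem_perp.2 (by simpa using hx 0)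
    have := hf.complete ⟨x, hxv⟩ fun i => by
      rw [h.restrict_apply]
      simpa using hx i.succ
    exact congrArg Subtype.val this

/-- Unimodular lattices of signature `(n, 1)` with a rational orthogonal frame have an orthonormal
basis. -/
theorem IsUnimodular.exists_orthonormal {n : ℕ} : ∀ {U : Type} [AddCommGroup U] [Module EisInt U]
    {h : HermForm U}, h.IsUnimodular → ∀ {a : EisInt}, a ≠ 0 → ∀ {f : Fin (n + 1) → U},
    h.IsFrame (sgn n) a f → ∃ e : Fin (n + 1) → U, h.IsFrame (sgn n) 1 e := by
  induction n with
  | zero => intro U _ _ h hU a ha f hf; exact hU.exists_frame_of_rank_one ha hf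
  | succ n ih =>
    intro U _ _ h hU a ha f hf
    obtain ⟨v, hv⟩ := hU.exists_norm_one ha hf
    obtain ⟨b, hb, f', hf'⟩ := hf.exists_perp ha hv
    obtain ⟨e, he⟩ := ih (hU.perp hv) hb hf'
    exact ⟨_, IsFrame.cons hv he⟩

/-- Any vector of norm `1` is the first vector of an orthonormal basis. -/
theorem IsUnimodular.exists_orthonormal_extending {n : ℕ} {U : Type} [AddCommGroup U]
    [Module EisInt U] {h : HermForm U} (hU : h.IsUnimodular) {a : EisInt} (ha : a ≠ 0)
    {f : Fin (n + 2) → U} (hf : h.IsFrame (sgn (n + 1)) a f) {v : U} (hv : h v v = 1) :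
    ∃ e : Fin (n + 2) → U, h.IsFrame (sgn (n + 1)) 1 e ∧ e 0 = v := by
  obtain ⟨b, hb, f', hf'⟩ := hf.exists_perp ha hv
  obtain ⟨e, he⟩ := (hU.perp hv).exists_orthonormal hb hf'
  exact ⟨_, IsFrame.cons hv he, rfl⟩

end HermForm

namespace TernaryForm

open LinearMap (BilinForm)

variable {V : Type*} [AddCommGroup V] [Module (ZMod 3) V]

theorem mul_self_of_ne_zero : ∀ {a : ZMod 3}, a ≠ 0 → a * a = 1 := by decide

/-- `G` consists of isometries of `B` fixing `u` and contains the reflections in the anisotropic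
vectors orthogonal to `u`. -/
structure IsReflectionGroup (B : BilinForm (ZMod 3) V) (u : V)
    (G : Subgroup (V ≃ₗ[ZMod 3] V)) : Prop where
  apply_apply : ∀ g ∈ G, ∀ x y, B (g x) (g y) = B x y
  apply_vector : ∀ g ∈ G, g u = u
  exists_reflection : ∀ v, B v v ≠ 0 → B v u = 0 →
    ∃ g ∈ G, ∀ x, g x = x + (B v v * B x v) • v

/-- `C` is totally isotropic and contains all isotropic vectors orthogonal to it. -/
structure IsMaxIsotropic (B : BilinForm (ZMod 3) V) (C : Submodule (ZMod 3) V) : Prop where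
  isotropic : ∀ x ∈ C, ∀ y ∈ C, B x y = 0
  maximal : ∀ x, B x x = 0 → (∀ y ∈ C, B x y = 0) → x ∈ C

variable {B : BilinForm (ZMod 3) V} {u : V} {G : Subgroup (V ≃ₗ[ZMod 3] V)}

namespace IsReflectionGroup

theorem exists_move_of_pairing_ne_zero (hG : IsReflectionGroup B u G) (hs : B.IsSymm)
    {S : Submodule (ZMod 3) V} (hu : u ∈ S) {a c : V} (haa : B a a = 0) (hcc : B c c = 0)
    (hac : B a c ≠ 0) (ha : ∀ x ∈ S, B x a = 0) (hc : ∀ x ∈ S, B x c = 0) :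
    ∃ g ∈ G, (∀ x ∈ S, g x = x) ∧ g a = c := by
  have hv : B (a - c) (a - c) = B a c := by
    have : B c a = B a c := hs.eq c a
    simp only [map_sub, LinearMap.sub_apply, haa, hcc, this]
    generalize B a c = m
    revert m; decide
  obtain ⟨g, hg, hgx⟩ := hG.exists_reflection (a - c) (by rw [hv]; exact hac)
    (by rw [hs.eq, map_sub, ha u hu, hc u hu, sub_zero])
  refine ⟨g, hg, fun x hx => ?_, ?_⟩
  · rw [hgx, map_sub (B x), ha x hx, hc x hx, sub_zero, mul_zero, zero_smul, add_zero]
  · rw [hgx, hv, map_sub, haa, zero_sub, mul_neg, mul_self_of_ne_zero hac, neg_one_smul]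
    abel

theorem exists_move_of_isotropic [FiniteDimensional (ZMod 3) V] (hG : IsReflectionGroup B u G)
    (hs : B.IsSymm) (hB : B.Nondegenerate)
    {S : Submodule (ZMod 3) V} (hu : u ∈ S) {a b : V} (haa : B a a = 0) (hbb : B b b = 0)
    (ha : ∀ x ∈ S, B x a = 0) (hb : ∀ x ∈ S, B x b = 0) (haS : a ∉ S) (hbS : b ∉ S) :
    ∃ g ∈ G, (∀ x ∈ S, g x = x) ∧ g a = b := by
  by_cases hab : B a b = 0
  swap
  · exact hG.exists_move_of_pairing_ne_zero hs hu haa hbb hab ha hb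
  have key : ∀ x, x ∉ S → ∃ c ∈ B.orthogonal S, B c x ≠ 0 := fun x hx => by
    by_contra! hcon
    rw [← LinearMap.BilinForm.orthogonal_orthogonal hB hs.isRefl S] at hx
    exact hx fun c hc => hcon c hc
  obtain ⟨c, hcS, hca, hcb⟩ : ∃ c ∈ B.orthogonal S, B c a ≠ 0 ∧ B c b ≠ 0 := by
    obtain ⟨c, hc, hca⟩ := key a haS
    obtain ⟨d, hd, hdb⟩ := key b hbS
    by_cases hcb : B c b = 0
    · by_cases hda : B d a = 0
      · refine ⟨c + d, add_mem hc hd, ?_, ?_⟩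
        · simpa [hda] using hca
        · simpa [hcb] using hdb
      · exact ⟨d, hd, hda, hdb⟩
    · exact ⟨c, hc, hca, hcb⟩
  rw [LinearMap.BilinForm.mem_orthogonal_iff] at hcS
  set e := c + (B c c * B c a) • a with he
  have hea : B e a = B c a := by simp [he, haa]
  have heb : B e b = B c b := by simp [he, hab]
  have hee : B e e = 0 := by
    have h1 : B e e = B c c + 2 * B c c * (B c a * B c a) := by
      have : B a c = B c a := hs.eq a c
      simp only [he, map_add, map_smul, LinearMap.add_apply, LinearMap.smul_apply, smul_eq_mul,
        haa, this]
      ring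
    rw [h1, mul_self_of_ne_zero hca]
    generalize B c c = m
    revert m; decide
  have heS : ∀ x ∈ S, B x e = 0 := fun x hx => by
    have : B x c = 0 := hcS x hx
    simp [he, this, ha x hx]
  obtain ⟨g₁, hg₁, hS₁, h₁⟩ := hG.exists_move_of_pairing_ne_zero hs hu haa hee
    (by rw [hs.eq, hea]; exact hca) ha heS
  obtain ⟨g₂, hg₂, hS₂, h₂⟩ := hG.exists_move_of_pairing_ne_zero hs hu hee hbb
    (by rw [heb]; exact hcb) heS hb
  refine ⟨g₂ * g₁, mul_mem hg₂ hg₁, fun x hx => ?_, ?_⟩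
  · rw [LinearEquiv.mul_apply, hS₁ x hx, hS₂ x hx]
  · rw [LinearEquiv.mul_apply, h₁, h₂]

theorem exists_move_of_norm_eq_neg_one (hG : IsReflectionGroup B u G) (hs : B.IsSymm)
    {S : Submodule (ZMod 3) V} (hu : u ∈ S) {w z : V} (hww : B w w = -1) (hzz : B z z = -1)
    (hw : ∀ x ∈ S, B x w = 0) (hz : ∀ x ∈ S, B x z = 0) :
    ∃ g ∈ G, (∀ x ∈ S, g x = x) ∧ g w = z := by
  have hzw : B z w = B w z := hs.eq z w
  by_cases hm : B w z = -1
  · have hv : B (w + z) (w + z) = -1 := by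
      simp only [map_add, LinearMap.add_apply, hww, hzz, hzw, hm]
      decide
    obtain ⟨g₁, hg₁, h₁⟩ := hG.exists_reflection (w + z) (by rw [hv]; decide)
      (by rw [hs.eq, map_add, hw u hu, hz u hu, add_zero])
    obtain ⟨g₂, hg₂, h₂⟩ := hG.exists_reflection z (by rw [hzz]; decide)
      (by rw [hs.eq, hz u hu])
    refine ⟨g₂ * g₁, mul_mem hg₂ hg₁, fun x hx => ?_, ?_⟩
    · rw [LinearEquiv.mul_apply, h₁, map_add (B x), hw x hx, hz x hx, add_zero, mul_zero,
        zero_smul, add_zero, h₂, hz x hx, mul_zero, zero_smul, add_zero]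
    · have h3 : g₁ w = -z := by
        rw [h₁, hv, map_add, hww, hm, show (-1 * (-1 + -1) : ZMod 3) = -1 by decide, neg_one_smul]
        abel
      rw [LinearEquiv.mul_apply, h3, h₂, hzz, map_neg, LinearMap.neg_apply, hzz,
        show (-1 * - -1 : ZMod 3) = 2 by decide, two_smul]
      abel
  · have hv : B (w - z) (w - z) = 1 + B w z := by
      simp only [map_sub, LinearMap.sub_apply, hww, hzz, hzw]
      generalize B w z = m
      revert m; decide
    have hm' : 1 + B w z ≠ 0 := fun h => hm (by linear_combination h)
    obtain ⟨g, hg, hgx⟩ := hG.exists_reflection (w - z) (by rw [hv]; exact hm')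
      (by rw [hs.eq, map_sub, hw u hu, hz u hu, sub_zero])
    refine ⟨g, hg, fun x hx => ?_, ?_⟩
    · rw [hgx, map_sub (B x), hw x hx, hz x hx, sub_zero, mul_zero, zero_smul, add_zero]
    · rw [hgx, hv, map_sub, hww, show -1 - B w z = -(1 + B w z) by ring, mul_neg,
        mul_self_of_ne_zero hm', neg_one_smul]
      abel

end IsReflectionGroup

theorem IsMaxIsotropic.map (hG : IsReflectionGroup B u G) {C : Submodule (ZMod 3) V}
    (hC : IsMaxIsotropic B C) {g : V ≃ₗ[ZMod 3] V} (hg : g ∈ G) :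
    IsMaxIsotropic B (C.map g.toLinearMap) := by
  refine ⟨?_, fun x hx h => ?_⟩
  · rintro _ ⟨x, hx, rfl⟩ _ ⟨y, hy, rfl⟩
    exact (hG.apply_apply g hg x y).trans (hC.isotropic x hx y hy)
  · refine ⟨g.symm x, hC.maximal _ ?_ fun y hy => ?_, g.apply_symm_apply x⟩
    · rw [← hG.apply_apply g hg, g.apply_symm_apply, hx]
    · rw [← hG.apply_apply g hg, g.apply_symm_apply]
      exact h _ ⟨y, hy, rfl⟩

theorem IsMaxIsotropic.apply_mem_iff (hG : IsReflectionGroup B u G) {C D : Submodule (ZMod 3) V}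
    (hC : IsMaxIsotropic B C) (hD : IsMaxIsotropic B D) {g : V ≃ₗ[ZMod 3] V} (hg : g ∈ G)
    (h : ∀ x ∈ C, g x ∈ D) (x : V) : g x ∈ D ↔ x ∈ C := by
  refine ⟨fun hx => hC.maximal _ ?_ fun y hy => ?_, h x⟩
  · rw [← hG.apply_apply g hg]
    exact hD.isotropic _ hx _ hx
  · rw [← hG.apply_apply g hg]
    exact hD.isotropic _ hx _ (h y hy)

theorem exists_mem_pairing_eq_one {C : Submodule (ZMod 3) V} (hC : ∃ x ∈ C, B x u ≠ 0) :
    ∃ x ∈ C, B x u = 1 := by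
  obtain ⟨x, hx, hxu⟩ := hC
  refine ⟨B x u • x, C.smul_mem _ hx, ?_⟩
  rw [map_smul, LinearMap.smul_apply, smul_eq_mul, mul_self_of_ne_zero hxu]

theorem IsReflectionGroup.exists_of_perp_le (hG : IsReflectionGroup B u G) (hs : B.IsSymm)
    (huu : B u u = 1) {C D : Submodule (ZMod 3) V} (hC : IsMaxIsotropic B C)
    (hD : IsMaxIsotropic B D) (hCu : ∃ x ∈ C, B x u ≠ 0) (hDu : ∃ x ∈ D, B x u ≠ 0)
    (hCD : ∀ x ∈ C, B x u = 0 → x ∈ D) : ∃ g ∈ G, ∀ x, g x ∈ D ↔ x ∈ C := by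
  obtain ⟨x, hx, hxu⟩ := exists_mem_pairing_eq_one hCu
  obtain ⟨y, hy, hyu⟩ := exists_mem_pairing_eq_one hDu
  have hux : B u x = 1 := by rw [hs.eq, hxu]
  have huy : B u y = 1 := by rw [hs.eq, hyu]
  have hS : ∀ z ∈ Submodule.span (ZMod 3) ({u} ∪ {z | z ∈ C ∧ B z u = 0}),
      B z (x - u) = 0 ∧ B z (y - u) = 0 := by
    intro z hz
    induction hz using Submodule.span_induction with
    | mem z hz =>
      rcases hz with rfl | ⟨hz, hzu⟩
      · simp [huu, hux, huy]
      · simp [hzu, hC.isotropic z hz x hx, hD.isotropic z (hCD z hz hzu) y hy]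
    | zero => simp
    | add a b _ _ ha hb =>
      simp only [map_add, LinearMap.add_apply, ha.1, hb.1, ha.2, hb.2, add_zero, and_self]
    | smul c a _ ha => simp only [map_smul, LinearMap.smul_apply, ha.1, ha.2, smul_zero, and_self]
  obtain ⟨g, hg, hgS, hgw⟩ := hG.exists_move_of_norm_eq_neg_one hs
    (Submodule.subset_span (Or.inl rfl))
    (show B (x - u) (x - u) = -1 by
      simp [huu, hux, hxu, hC.isotropic x hx x hx])
    (show B (y - u) (y - u) = -1 by
      simp [huu, huy, hyu, hD.isotropic y hy y hy])
    (fun z hz => (hS z hz).1) (fun z hz => (hS z hz).2)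
  have hgx : g x = y := by
    rw [map_sub, hG.apply_vector g hg] at hgw
    exact sub_left_inj.1 hgw
  refine ⟨g, hg, hC.apply_mem_iff hG hD hg fun z hz => ?_⟩
  have h1 : z - B z u • x ∈ C := sub_mem hz (C.smul_mem _ hx)
  have h2 : B (z - B z u • x) u = 0 := by simp [hxu]
  have h3 := hgS _ (Submodule.subset_span (Or.inr ⟨h1, h2⟩))
  rw [map_sub, map_smul, hgx] at h3
  have h4 : g z = (z - B z u • x) + B z u • y := by rw [← h3]; abel
  rw [h4]
  exact add_mem (hCD _ h1 h2) (D.smul_mem _ hy)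

/-- Witt's theorem: maximal isotropic subspaces not orthogonal to `u` are equivalent under the
stabilizer of `u`. -/
theorem IsReflectionGroup.exists_apply_mem_iff [FiniteDimensional (ZMod 3) V]
    (hG : IsReflectionGroup B u G) (hs : B.IsSymm) (hB : B.Nondegenerate) (huu : B u u = 1)
    {C D : Submodule (ZMod 3) V} (hC : IsMaxIsotropic B C)
    (hD : IsMaxIsotropic B D) (hCu : ∃ x ∈ C, B x u ≠ 0) (hDu : ∃ x ∈ D, B x u ≠ 0) :
    ∃ g ∈ G, ∀ x, g x ∈ D ↔ x ∈ C := by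
  suffices H : ∀ F : Submodule (ZMod 3) V, ∀ C : Submodule (ZMod 3) V, IsMaxIsotropic B C →
      (∃ x ∈ C, B x u ≠ 0) → F ≤ C → F ≤ D → (∀ x ∈ F, B x u = 0) →
      ∃ g ∈ G, ∀ x, g x ∈ D ↔ x ∈ C from
    H ⊥ C hC hCu bot_le bot_le fun x hx => by simp [(Submodule.mem_bot _).1 hx]
  intro F
  induction F using WellFoundedGT.induction with
  | ind F ih =>
  intro C hC hCu hFC hFD hFu
  by_cases h1 : ∀ x ∈ C, B x u = 0 → x ∈ F
  · exact hG.exists_of_perp_le hs huu hC hD hCu hDu fun x hx hxu => hFD (h1 x hx hxu)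
  by_cases h2 : ∀ x ∈ D, B x u = 0 → x ∈ F
  · obtain ⟨g, hg, hgx⟩ := hG.exists_of_perp_le hs huu hD hC hDu hCu
      fun x hx hxu => hFC (h2 x hx hxu)
    refine ⟨g⁻¹, inv_mem hg, fun x => ?_⟩
    rw [← hgx]
    change g (g.symm x) ∈ C ↔ _
    rw [g.apply_symm_apply]
  push Not at h1 h2
  obtain ⟨a, haC, hau, haF⟩ := h1
  obtain ⟨b, hbD, hbu, hbF⟩ := h2
  have hnot : ∀ x, B x u = 0 → x ∉ F → x ∉ F ⊔ Submodule.span (ZMod 3) {u} := by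
    intro x hxu hxF hx
    obtain ⟨f, hf, _, hc, rfl⟩ := Submodule.mem_sup.1 hx
    obtain ⟨c, rfl⟩ := Submodule.mem_span_singleton.1 hc
    have hc0 : c = 0 := by simpa [hFu f hf, huu] using hxu
    rw [hc0, zero_smul, add_zero] at hxF
    exact hxF hf
  have hperp : ∀ x, B x u = 0 → (∀ f ∈ F, B f x = 0) →
      ∀ y ∈ F ⊔ Submodule.span (ZMod 3) {u}, B y x = 0 := by
    intro x hxu hxF y hy
    obtain ⟨f, hf, _, hc, rfl⟩ := Submodule.mem_sup.1 hy
    obtain ⟨c, rfl⟩ := Submodule.mem_span_singleton.1 hc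
    have hux : B u x = 0 := by rw [hs.eq, hxu]
    simp [hxF f hf, hux]
  obtain ⟨g, hg, hgS, hga⟩ := hG.exists_move_of_isotropic hs hB
    (S := F ⊔ Submodule.span (ZMod 3) {u})
    (Submodule.mem_sup_right (Submodule.mem_span_singleton_self u))
    (hC.isotropic a haC a haC) (hD.isotropic b hbD b hbD)
    (hperp a hau fun f hf => hC.isotropic f (hFC hf) a haC)
    (hperp b hbu fun f hf => hD.isotropic f (hFD hf) b hbD)
    (hnot a hau haF) (hnot b hbu hbF)
  have hlt : F < F ⊔ Submodule.span (ZMod 3) {b} := by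
    refine lt_of_le_of_ne le_sup_left fun h => hbF ?_
    rw [h]
    exact Submodule.mem_sup_right (Submodule.mem_span_singleton_self b)
  obtain ⟨g', hg', hgx⟩ := ih _ hlt (C.map g.toLinearMap) (hC.map hG hg)
    (by
      obtain ⟨x, hx, hxu⟩ := hCu
      refine ⟨g x, ⟨x, hx, rfl⟩, ?_⟩
      have := hG.apply_apply g hg x u
      rw [hG.apply_vector g hg] at this
      rwa [this])
    (by
      refine sup_le (fun f hf => ⟨f, hFC hf, hgS f (Submodule.mem_sup_left hf)⟩) ?_
      rw [Submodule.span_singleton_le_iff_mem]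
      exact ⟨a, haC, hga⟩)
    (sup_le hFD ((Submodule.span_singleton_le_iff_mem _ _).2 hbD))
    (by
      intro x hx
      obtain ⟨f, hf, _, hc, rfl⟩ := Submodule.mem_sup.1 hx
      obtain ⟨c, rfl⟩ := Submodule.mem_span_singleton.1 hc
      simp [hFu f hf, hbu])
  refine ⟨g' * g, mul_mem hg' hg, fun x => ?_⟩
  rw [LinearEquiv.mul_apply, hgx]
  exact ⟨fun ⟨y, hy, hyx⟩ => g.injective hyx ▸ hy, fun hx => ⟨x, hx, rfl⟩⟩

end TernaryForm

namespace StdForm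

open LinearMap (BilinForm)
open HermForm (sgn sgn_last sgn_castSucc sgn_mul_self star_sgn)
open EisInt (red th)

/-- The standard Hermitian form of signature `(n, 1)`. -/
def std (n : ℕ) : HermForm (Fin (n + 1) → EisInt) where
  toFun x y := ∑ i, sgn n i * x i * star (y i)
  add_left' x y z := by
    rw [← Finset.sum_add_distrib]
    exact Finset.sum_congr rfl fun i _ => by rw [Pi.add_apply]; ring
  smul_left' c x y := by
    rw [Finset.mul_sum]
    exact Finset.sum_congr rfl fun i _ => by rw [Pi.smul_apply, smul_eq_mul]; ring
  star_apply' x y := by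
    rw [star_sum]
    exact Finset.sum_congr rfl fun i _ => by
      rw [star_mul', star_mul', star_star, star_sgn]; ring

theorem std_apply (n : ℕ) (x y : Fin (n + 1) → EisInt) :
    std n x y = ∑ i, sgn n i * x i * star (y i) := rfl

theorem std_single (n : ℕ) (x : Fin (n + 1) → EisInt) (i : Fin (n + 1)) :
    std n x (Pi.single i 1) = sgn n i * x i := by
  rw [std_apply, Finset.sum_eq_single i]
  · simp
  · intro j _ hj
    simp [hj]
  · simp

/-- The reduction of the standard form modulo `θ`. -/
def stdRed (n : ℕ) : BilinForm (ZMod 3) (Fin (n + 1) → ZMod 3) :=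
  Matrix.toBilin' (Matrix.diagonal fun i => red (sgn n i))

theorem stdRed_apply (n : ℕ) (x y : Fin (n + 1) → ZMod 3) :
    stdRed n x y = ∑ i, red (sgn n i) * x i * y i := by
  rw [stdRed, Matrix.toBilin'_apply]
  refine Finset.sum_congr rfl fun i _ => ?_
  rw [Finset.sum_eq_single i]
  · rw [Matrix.diagonal_apply_eq]; ring
  · intro j _ hj
    rw [Matrix.diagonal_apply_ne _ hj.symm]; ring
  · simp

theorem stdRed_isSymm (n : ℕ) : (stdRed n).IsSymm :=
  ⟨fun x y => by
    rw [stdRed_apply, stdRed_apply]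
    exact Finset.sum_congr rfl fun i _ => by ring⟩

theorem stdRed_nondegenerate (n : ℕ) : (stdRed n).Nondegenerate := by
  refine LinearMap.BilinForm.nondegenerate_toBilin'_of_det_ne_zero' _ ?_
  rw [Matrix.det_diagonal, Finset.prod_ne_zero_iff]
  intro i _ h
  have := congrArg red (sgn_mul_self n i)
  rw [map_mul, h, zero_mul, map_one] at this
  exact zero_ne_one this

/-- Coordinatewise reduction modulo `θ`. -/
def redVec (n : ℕ) : (Fin (n + 1) → EisInt) →ₛₗ[red] (Fin (n + 1) → ZMod 3) where
  toFun x i := red (x i)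
  map_add' _ _ := funext fun _ => map_add red _ _
  map_smul' _ _ := funext fun _ => map_mul red _ _

theorem redVec_apply (n : ℕ) (x : Fin (n + 1) → EisInt) (i : Fin (n + 1)) :
    redVec n x i = red (x i) := rfl

theorem redVec_surjective (n : ℕ) : Function.Surjective (redVec n) := fun y => by
  choose f hf using EisInt.red_surjective
  exact ⟨fun i => f (y i), funext fun i => hf _⟩

theorem redVec_single (n : ℕ) (i : Fin (n + 1)) :
    redVec n (Pi.single i 1) = Pi.single i 1 := by
  ext j
  rw [redVec_apply]
  by_cases h : j = i
  · subst h; simp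
  · simp [h]

theorem red_std (n : ℕ) (x y : Fin (n + 1) → EisInt) :
    red (std n x y) = stdRed n (redVec n x) (redVec n y) := by
  rw [std_apply, stdRed_apply, map_sum]
  exact Finset.sum_congr rfl fun i _ => by
    rw [map_mul, map_mul, EisInt.red_star, redVec_apply, redVec_apply]

/-- Isometries modulo `θ` that lift to isometries fixing the first basis vector. -/
def liftable (n : ℕ) : Subgroup ((Fin (n + 1) → ZMod 3) ≃ₗ[ZMod 3] (Fin (n + 1) → ZMod 3)) where
  carrier := {g | ∃ G : (Fin (n + 1) → EisInt) ≃ₗ[EisInt] (Fin (n + 1) → EisInt),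
    (∀ x y, std n (G x) (G y) = std n x y) ∧ G (Pi.single 0 1) = Pi.single 0 1 ∧
      ∀ x, redVec n (G x) = g (redVec n x)}
  mul_mem' := by
    rintro g g' ⟨G, h1, h2, h3⟩ ⟨G', h1', h2', h3'⟩
    refine ⟨G'.trans G, fun x y => ?_, ?_, fun x => ?_⟩
    · rw [LinearEquiv.trans_apply, LinearEquiv.trans_apply, h1, h1']
    · rw [LinearEquiv.trans_apply, h2', h2]
    · rw [LinearEquiv.trans_apply, h3, h3', LinearEquiv.mul_apply]
  one_mem' := ⟨LinearEquiv.refl _ _, fun _ _ => rfl, rfl, fun _ => rfl⟩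
  inv_mem' := by
    rintro g ⟨G, h1, h2, h3⟩
    refine ⟨G.symm, fun x y => ?_, ?_, fun x => ?_⟩
    · rw [← h1, G.apply_symm_apply, G.apply_symm_apply]
    · rw [LinearEquiv.symm_apply_eq, h2]
    · have := h3 (G.symm x)
      rw [G.apply_symm_apply] at this
      rw [this]
      exact (g.symm_apply_apply _).symm

theorem exists_last_coordinate : ∀ S : Fin 10, ∀ a : ZMod 3, (S.val : ZMod 3) - a * a ≠ 0 →
    ∃ t ∈ [(0 : EisInt), th, 3, 1, -1, 2, -2, ⟨3, 1⟩, ⟨-3, -1⟩], red t = a ∧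
      ∃ p ∈ [((1 : ℤ), (2 : ℤ)), (2, 1), (-1, -2), (-2, -1)],
        (S.val : EisInt) - t * star t = p.1 := by
  decide

theorem exists_lift_of_norm : ∀ a : ZMod 3, ∃ t ∈ [(0 : EisInt), 1, -1], red t = a ∧
    ∃ k ∈ [0, 1], t * star t = (k : ℕ) ∧ (a = 0 → t = 0 ∧ k = 0) := by
  decide

/-- Anisotropic vectors orthogonal to the first basis vector lift to vectors of norm dividing
`2`. -/
theorem exists_lift {v : Fin 11 → ZMod 3} (h0 : v 0 = 0) (hv : stdRed 10 v v ≠ 0) :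
    ∃ w, redVec 10 w = v ∧ w 0 = 0 ∧ ∃ m n : ℤ, std 10 w w = n ∧ n * m = 2 := by
  choose t ht htr k hk htk hz using exists_lift_of_norm
  have hS : ∑ i : Fin 10, k (v i.castSucc) < 10 := by
    rw [Fin.sum_univ_succ]
    have h1 : k (v (Fin.castSucc 0)) = 0 := (hz _ (by simpa using h0)).2
    have h2 : ∑ i : Fin 9, k (v i.succ.castSucc) ≤ ∑ i : Fin 9, 1 :=
      Finset.sum_le_sum fun i _ => by
        have := hk (v i.succ.castSucc)
        simp only [List.mem_cons, List.not_mem_nil, or_false] at this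
        omega
    simp only [Finset.sum_const, Finset.card_univ, Fintype.card_fin, smul_eq_mul] at h2
    omega
  have hred : stdRed 10 v v
      = ((∑ i : Fin 10, k (v i.castSucc) : ℕ) : ZMod 3) - v (Fin.last 10) * v (Fin.last 10) := by
    rw [stdRed_apply, Fin.sum_univ_castSucc, sgn_last, map_neg, map_one, Nat.cast_sum]
    have : ∀ i : Fin 10, red (sgn 10 i.castSucc) * v i.castSucc * v i.castSucc
        = (k (v i.castSucc) : ZMod 3) := fun i => by
      rw [sgn_castSucc, map_one, one_mul, ← map_natCast red, ← htk, map_mul, EisInt.red_star, htr]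
    rw [Finset.sum_congr rfl fun i _ => this i]
    ring
  rw [hred] at hv
  obtain ⟨s, -, hs, p, hp, hsp⟩ := exists_last_coordinate ⟨_, hS⟩ _ hv
  refine ⟨Fin.snoc (α := fun _ => EisInt) (fun i : Fin 10 => t (v i.castSucc)) s, ?_, ?_, p.2, p.1,
    ?_, ?_⟩
  · ext i
    rw [redVec_apply]
    refine Fin.lastCases ?_ (fun j => ?_) i
    · rw [Fin.snoc_last, hs]
    · rw [Fin.snoc_castSucc, htr]
  · rw [show (0 : Fin 11) = Fin.castSucc 0 from rfl, Fin.snoc_castSucc]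
    exact (hz _ h0).1
  · rw [std_apply, Fin.sum_univ_castSucc, ← hsp]
    simp only [Fin.snoc_castSucc, Fin.snoc_last, sgn_castSucc, sgn_last, one_mul, htk]
    push_cast
    ring
  · simp only [List.mem_cons, List.not_mem_nil, or_false] at hp
    rcases hp with rfl | rfl | rfl | rfl <;> rfl

/-- The reflection in a vector `v` with `m * ⟨v, v⟩ = 2`. -/
theorem exists_integral_reflection {n : ℕ} {v : Fin (n + 1) → EisInt} {a m : ℤ}
    (hv : std n v v = a) (ham : a * m = 2) :
    ∃ G : (Fin (n + 1) → EisInt) ≃ₗ[EisInt] (Fin (n + 1) → EisInt),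
      (∀ x y, std n (G x) (G y) = std n x y) ∧ ∀ x, G x = x - ((m : EisInt) * std n x v) • v := by
  have ham' : (a : EisInt) * m = 2 := by exact_mod_cast congrArg (Int.cast : ℤ → EisInt) ham
  let R : (Fin (n + 1) → EisInt) →ₗ[EisInt] (Fin (n + 1) → EisInt) :=
    LinearMap.id - ((m : EisInt) • (std n).pairing v).smulRight v
  have hR : ∀ x, R x = x - ((m : EisInt) * std n x v) • v := fun x => rfl
  have hinv : Function.Involutive R := fun x => by
    rw [hR, hR, HermForm.sub_left, HermForm.smul_left, hv, sub_sub, ← add_smul,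
      show (m : EisInt) * std n x v + m * (std n x v - m * std n x v * a) = 0 by
        linear_combination (-(m : EisInt) * std n x v) * ham', zero_smul, sub_zero]
  refine ⟨LinearEquiv.ofInvolutive R hinv, fun x y => ?_, hR⟩
  change std n (R x) (R y) = _
  rw [hR, hR]
  simp only [HermForm.sub_left, HermForm.sub_right, HermForm.smul_left, HermForm.smul_right, hv,
    star_mul', star_intCast]
  rw [(std n).star_apply y v]
  linear_combination ((m : EisInt) * std n x v * std n v y) * ham'

theorem isReflectionGroup_liftable :
    TernaryForm.IsReflectionGroup (stdRed 10) (Pi.single 0 1) (liftable 10) where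
  apply_apply := by
    rintro g ⟨G, h1, h2, h3⟩ x y
    obtain ⟨x, rfl⟩ := redVec_surjective 10 x
    obtain ⟨y, rfl⟩ := redVec_surjective 10 y
    rw [← h3, ← h3, ← red_std, h1, red_std]
  apply_vector := by
    rintro g ⟨G, h1, h2, h3⟩
    have := h3 (Pi.single 0 1)
    rw [h2, redVec_single] at this
    exact this.symm
  exists_reflection := by
    intro v hv hvu
    have h0 : v 0 = 0 := by
      have h1 : redVec 10 (Pi.single 0 1) = Pi.single 0 1 := redVec_single 10 0
      obtain ⟨w, rfl⟩ := redVec_surjective 10 v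
      rw [← h1, ← red_std, std_single, map_mul] at hvu
      exact (one_mul _).symm.trans hvu
    obtain ⟨w, rfl, hw0, m, n, hn, hnm⟩ := exists_lift h0 hv
    obtain ⟨G, hG, hGx⟩ := exists_integral_reflection hn hnm
    have hm : red m = -stdRed 10 (redVec 10 w) (redVec 10 w) := by
      have h1 := congrArg (Int.cast : ℤ → ZMod 3) hnm
      have h2 : stdRed 10 (redVec 10 w) (redVec 10 w) = n := by
        rw [← red_std, hn, map_intCast]
      rw [h2] at hv ⊢
      rw [map_intCast]
      push_cast at h1
      generalize (m : ZMod 3) = a at *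
      generalize (n : ZMod 3) = b at *
      clear hn hnm hGx h2
      revert a b
      decide
    set v := redVec 10 w
    have hGr : ∀ x, redVec 10 (G x)
        = redVec 10 x + (stdRed 10 v v * stdRed 10 (redVec 10 x) v) • v := fun x => by
      rw [hGx, map_sub, LinearMap.map_smulₛₗ, map_mul, hm, red_std, neg_mul, neg_smul,
        sub_neg_eq_add]
    let L : (Fin 11 → ZMod 3) →ₗ[ZMod 3] (Fin 11 → ZMod 3) :=
      LinearMap.id + (stdRed 10 v v • (stdRed 10).flip v).smulRight v
    have hL : ∀ x, L x = x + (stdRed 10 v v * stdRed 10 x v) • v := fun x => rfl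
    have hinv : Function.Involutive L := fun x => by
      rw [hL, hL, map_add, map_smul, LinearMap.add_apply, LinearMap.smul_apply, smul_eq_mul,
        add_assoc, ← add_smul]
      have h1 := TernaryForm.mul_self_of_ne_zero hv
      have h3 : (3 : ZMod 3) = 0 := by decide
      have h4 : stdRed 10 v v * stdRed 10 x v
          + stdRed 10 v v * (stdRed 10 x v
            + stdRed 10 v v * stdRed 10 x v * stdRed 10 v v) = 0 := by
        linear_combination (stdRed 10 v v * stdRed 10 x v) * h1
          + (stdRed 10 v v * stdRed 10 x v) * h3
      rw [h4, zero_smul, add_zero]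
    refine ⟨LinearEquiv.ofInvolutive L hinv, ⟨G, hG, ?_, fun x => ?_⟩, hL⟩
    · have : std 10 (Pi.single 0 1) w = 0 := by
        rw [← HermForm.star_apply, std_single, hw0, mul_zero, star_zero]
      rw [hGx, this, mul_zero, zero_smul, sub_zero]
    · rw [hGr]
      rfl

end StdForm

namespace NodalLattice

open HermForm (sgn)
open EisInt (red th)

/-- The Hermitian form with a given Gram matrix. -/
def ofGram {n : ℕ} (M : Matrix (Fin n) (Fin n) EisInt) (hM : ∀ i j, star (M i j) = M j i) :
    HermForm (Fin n → EisInt) where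
  toFun x y := ∑ i, ∑ j, M i j * x i * star (y j)
  add_left' x y z := by
    simp only [← Finset.sum_add_distrib, Pi.add_apply]
    exact Finset.sum_congr rfl fun i _ => Finset.sum_congr rfl fun j _ => by ring
  smul_left' c x y := by
    simp only [Finset.mul_sum, Pi.smul_apply, smul_eq_mul]
    exact Finset.sum_congr rfl fun i _ => Finset.sum_congr rfl fun j _ => by ring
  star_apply' x y := by
    simp only [star_sum, star_mul', star_star, hM]
    rw [Finset.sum_comm]
    exact Finset.sum_congr rfl fun i _ => Finset.sum_congr rfl fun j _ => by ring

/-- The block diagonal matrix with blocks `(a)`, `P`, `P`, `Q`. -/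
def blocks (a : EisInt) (P : Matrix (Fin 4) (Fin 4) EisInt) (Q : Matrix (Fin 2) (Fin 2) EisInt) :
    Matrix (Fin 11) (Fin 11) EisInt := Matrix.of fun i j =>
  if i.val = 0 ∧ j.val = 0 then a
  else if h : (1 ≤ i.val ∧ i.val < 5) ∧ 1 ≤ j.val ∧ j.val < 5 then
    P ⟨i.val - 1, by omega⟩ ⟨j.val - 1, by omega⟩
  else if h : (5 ≤ i.val ∧ i.val < 9) ∧ 5 ≤ j.val ∧ j.val < 9 then
    P ⟨i.val - 5, by omega⟩ ⟨j.val - 5, by omega⟩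
  else if h : 9 ≤ i.val ∧ 9 ≤ j.val then
    Q ⟨i.val - 9, by omega⟩ ⟨j.val - 9, by omega⟩
  else 0

/-- The Gram matrix of `E₈`. -/
def gramB : Matrix (Fin 4) (Fin 4) EisInt :=
  !![3, th, 0, 0; -th, 3, th, 0; 0, -th, 3, th; 0, 0, -th, 3]

/-- The Gram matrix of the hyperbolic cell. -/
def gramC : Matrix (Fin 2) (Fin 2) EisInt := !![0, th; -th, 0]

/-- The Gram matrix of the lattice. -/
def gram : Matrix (Fin 11) (Fin 11) EisInt := blocks 3 gramB gramC

/-- A matrix with `gram * dualMatrix = diag(3, θ, …, θ)`. -/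
def dualMatrix : Matrix (Fin 11) (Fin 11) EisInt :=
  blocks 1 !![th, 2, -th, -1; -2, 2 * th, 3, -th; -th, -3, 2 * th, 2; 1, -th, -2, th]
    !![0, -1; 1, 0]

/-- The rows of this matrix are orthogonal vectors of norm `±3`. -/
def frameMatrix : Matrix (Fin 11) (Fin 11) EisInt :=
  blocks 1 !![1, 0, 0, 0; 0, 0, 0, -1; ⟨1, 1⟩, ⟨1, -1⟩, -th, -1; ⟨-1, -1⟩, ⟨-1, 1⟩, ⟨2, 1⟩, ⟨0, -1⟩]
    !![1, ⟨0, 1⟩; 1, ⟨-1, -1⟩]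

theorem star_gram : ∀ i j, star (gram i j) = gram j i := by decide +kernel

theorem red_gram : ∀ i j, red (gram i j) = 0 := by decide +kernel

theorem gram_mul_dualMatrix : ∀ i j, ∑ k, gram i k * dualMatrix k j
    = if i = j then (if i = 0 then 3 else th) else 0 := by decide +kernel

theorem gram_frameMatrix : ∀ i j, ∑ k, ∑ l, gram k l * frameMatrix i k * star (frameMatrix j l)
    = if i = j then sgn 10 i * 3 else 0 := by decide +kernel

theorem gram_mul_frameMatrix_mul : ∀ i j,
    ∑ k, (∑ l, gram i l * star (frameMatrix k l)) * (sgn 10 k * frameMatrix k j)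
    = if i = j then 3 else 0 := by decide +kernel

/-- The Hermitian form of the lattice. -/
def form : HermForm (Fin 11 → EisInt) := ofGram gram star_gram

theorem form_apply (x y : Fin 11 → EisInt) :
    form x y = ∑ i, ∑ j, gram i j * x i * star (y j) := rfl

theorem form_single_left (i : Fin 11) (y : Fin 11 → EisInt) :
    form (Pi.single i 1) y = ∑ j, gram i j * star (y j) := by
  rw [form_apply, Finset.sum_eq_single i]
  · simp
  · intro j _ hj
    simp [hj]
  · simp

theorem form_single_right (y : Fin 11 → EisInt) (i : Fin 11) :
    form y (Pi.single i 1) = ∑ j, y j * gram j i := by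
  rw [← HermForm.star_apply, form_single_left, star_sum]
  exact Finset.sum_congr rfl fun j _ => by rw [star_mul', star_star, star_gram]; ring

theorem th_dvd_form (x y : Fin 11 → EisInt) : th ∣ form x y := by
  rw [form_apply]
  refine Finset.dvd_sum fun i _ => Finset.dvd_sum fun j _ => ?_
  rw [mul_assoc]
  exact (EisInt.red_eq_zero_iff.1 (red_gram i j)).mul_right _

theorem three_dvd_form_self (x : Fin 11 → EisInt) : (3 : EisInt) ∣ form x x :=
  EisInt.three_dvd_of_star_eq (form.star_apply x x) (th_dvd_form x x)

theorem exists_form_eq {φ : (Fin 11 → EisInt) →ₗ[EisInt] EisInt}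
    (h0 : (3 : EisInt) ∣ φ (Pi.single 0 1)) (h : ∀ i, th ∣ φ (Pi.single i 1)) :
    ∃ y, ∀ x, φ x = form x y := by
  have hc : ∀ i, ∃ c, φ (Pi.single i 1) = (if i = 0 then 3 else th) * c := fun i => by
    split_ifs with hi
    · subst hi; exact h0
    · exact h i
  choose c hc using hc
  refine ⟨fun j => star (∑ k, dualMatrix j k * c k), fun x => ?_⟩
  refine LinearMap.congr_fun (g := form.pairing _) (LinearMap.pi_ext' fun i => ?_) x
  refine LinearMap.ext_ring ?_
  change φ (Pi.single i 1) = form (Pi.single i 1) _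
  rw [form_single_left, hc]
  simp only [star_star, Finset.mul_sum]
  rw [Finset.sum_comm]
  simp only [← mul_assoc, ← Finset.sum_mul, gram_mul_dualMatrix]
  simp

theorem th_dvd_of_three_dvd_form {y : Fin 11 → EisInt} (h : ∀ z, (3 : EisInt) ∣ form y z)
    {i : Fin 11} (hi : i ≠ 0) : th ∣ y i := by
  have h1 : ∑ k, form y (Pi.single k 1) * dualMatrix k i = y i * th := by
    simp only [form_single_right, Finset.sum_mul]
    rw [Finset.sum_comm]
    simp only [mul_assoc, ← Finset.mul_sum, gram_mul_dualMatrix]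
    simp only [mul_ite, mul_zero, Finset.sum_ite_eq', Finset.mem_univ, if_true, if_neg hi]
  have h2 : (3 : EisInt) ∣ y i * th := by
    rw [← h1]
    exact Finset.dvd_sum fun k _ => (h _).mul_right _
  obtain ⟨c, hc⟩ := h2
  refine ⟨-c, mul_right_cancel₀ EisInt.th_ne_zero ?_⟩
  rw [hc]
  linear_combination c * EisInt.th_mul_th

theorem form_frameMatrix (i j : Fin 11) :
    form (frameMatrix i) (frameMatrix j) = if i = j then sgn 10 i * 3 else 0 :=
  gram_frameMatrix i j

theorem eq_zero_of_form_frameMatrix {x : Fin 11 → EisInt}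
    (h : ∀ i, form x (frameMatrix i) = 0) : x = 0 := by
  ext1 j
  have h1 : ∑ k, form x (frameMatrix k) * (sgn 10 k * frameMatrix k j) = x j * 3 := by
    have h2 : ∀ k, form x (frameMatrix k) * (sgn 10 k * frameMatrix k j)
        = ∑ i, x i * ((∑ l, gram i l * star (frameMatrix k l)) * (sgn 10 k * frameMatrix k j)) := by
      intro k
      rw [form_apply, Finset.sum_mul]
      refine Finset.sum_congr rfl fun i _ => ?_
      rw [← mul_assoc (x i), Finset.mul_sum]
      congr 1
      exact Finset.sum_congr rfl fun l _ => by ring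
    rw [Finset.sum_congr rfl fun k _ => h2 k, Finset.sum_comm]
    simp only [← Finset.mul_sum, gram_mul_frameMatrix_mul]
    simp
  simp only [h, zero_mul, Finset.sum_const_zero] at h1
  exact (mul_eq_zero.1 h1.symm).resolve_right EisInt.three_ne_zero

end NodalLattice

/-- Division of a Hermitian form by a real common divisor of its values. -/
def HermForm.divide {U : Type*} [AddCommGroup U] [Module EisInt U] (h : HermForm U) {c : EisInt}
    (hc : c ≠ 0) (hcs : star c = c) (hd : ∀ x y, c ∣ h x y) : HermForm U where
  toFun x y := (hd x y).choose
  add_left' x y z := mul_left_cancel₀ hc <| by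
    rw [mul_add, ← (hd _ _).choose_spec, ← (hd _ _).choose_spec, ← (hd _ _).choose_spec, h.add_left]
  smul_left' a x y := mul_left_cancel₀ hc <| by
    rw [mul_left_comm, ← (hd _ _).choose_spec, ← (hd _ _).choose_spec, h.smul_left]
  star_apply' x y := mul_left_cancel₀ hc <| by
    nth_rw 1 [← hcs]
    rw [← star_mul', ← (hd _ _).choose_spec, ← (hd _ _).choose_spec, h.star_apply]

theorem HermForm.mul_divide {U : Type*} [AddCommGroup U] [Module EisInt U] (h : HermForm U)
    {c : EisInt} (hc : c ≠ 0) (hcs : star c = c) (hd : ∀ x y, c ∣ h x y) (x y : U) :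
    c * h.divide hc hcs hd x y = h x y := (hd x y).choose_spec.symm

namespace NodalLattice

open HermForm (sgn sgn_mul_self)
open EisInt (red th)
open StdForm

/-- `j` identifies the lattice with a sublattice of the standard unimodular lattice containing its
`θ`-multiple, is maximal isotropic modulo `θ`, and carries `r` to `θ` times the first basis
vector. -/
structure IsStdEmbedding (r : Fin 11 → EisInt)
    (j : (Fin 11 → EisInt) →ₗ[EisInt] (Fin 11 → EisInt)) : Prop where
  injective : Function.Injective j
  std_apply : ∀ x y, std 10 (j x) (j y) = form x y
  apply_root : j r = th • Pi.single 0 1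
  smul_mem : ∀ x, th • x ∈ LinearMap.range j
  mem_range : ∀ x, th ∣ std 10 x x → (∀ y, th ∣ std 10 x (j y)) → x ∈ LinearMap.range j
  exists_apply_zero : ∃ y, ¬ th ∣ j y 0

theorem three_dvd_form_of_mem_span {s : Set (Fin 11 → EisInt)}
    (hs : ∀ x ∈ s, ∀ y ∈ s, (3 : EisInt) ∣ form x y) {x y : Fin 11 → EisInt}
    (hx : x ∈ Submodule.span EisInt s) (hy : y ∈ Submodule.span EisInt s) :
    (3 : EisInt) ∣ form x y := by
  have key : ∀ y, (∀ x ∈ s, (3 : EisInt) ∣ form x y) →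
      ∀ x ∈ Submodule.span EisInt s, (3 : EisInt) ∣ form x y := by
    intro y hy x hx
    have : Submodule.span EisInt s ≤
        Submodule.comap (form.pairing y) (Ideal.span {(3 : EisInt)} : Submodule EisInt EisInt) :=
      Submodule.span_le.2 fun z hz => Ideal.mem_span_singleton.2 (hy z hz)
    exact Ideal.mem_span_singleton.1 (this hx)
  refine key y (fun z hz => ?_) x hx
  obtain ⟨c, hc⟩ := key z (fun w hw => hs w hw z hz) y hy
  refine ⟨star c, ?_⟩
  rw [← form.star_apply, hc, star_mul', star_ofNat]

theorem form_single_zero (y : Fin 11 → EisInt) : form (Pi.single 0 1) y = 3 * star (y 0) := by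
  rw [form_single_left, Finset.sum_eq_single 0]
  · rfl
  · intro j _ hj
    have : gram 0 j = 0 := by
      revert j
      decide +kernel
    rw [this, zero_mul]
  · simp

theorem three_dvd_of_th_dvd {z : EisInt} (hz : th ∣ z) : (3 : EisInt) ∣ th * z := by
  obtain ⟨c, rfl⟩ := hz
  exact ⟨-c, by linear_combination c * EisInt.th_mul_th⟩

/-- Every root lies, together with the first basis vector, in a maximal `3`-divisible
sublattice. -/
theorem exists_maximal_sublattice {r : Fin 11 → EisInt} (hr : form r r = 3) :
    ∃ W : Submodule EisInt (Fin 11 → EisInt), r ∈ W ∧ Pi.single 0 1 ∈ W ∧ (∀ x, th • x ∈ W) ∧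
      (∀ x ∈ W, ∀ y ∈ W, (3 : EisInt) ∣ form x y) ∧
      ∀ y, (∀ x ∈ W, (3 : EisInt) ∣ form x y) → y ∈ W := by
  let A : Set (Submodule EisInt (Fin 11 → EisInt)) :=
    {W | r ∈ W ∧ Pi.single 0 1 ∈ W ∧ (∀ x, th • x ∈ W) ∧
      ∀ x ∈ W, ∀ y ∈ W, (3 : EisInt) ∣ form x y}
  have hth : ∀ x y, (3 : EisInt) ∣ form (th • x) y := fun x y => by
    rw [form.smul_left]
    exact three_dvd_of_th_dvd (th_dvd_form x y)
  have hsymm : ∀ x y, (3 : EisInt) ∣ form x y → (3 : EisInt) ∣ form y x := fun x y hxy => by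
    obtain ⟨c, hc⟩ := hxy
    exact ⟨star c, by rw [← form.star_apply, hc, star_mul', star_ofNat]⟩
  have h0 : ∀ y, (3 : EisInt) ∣ form (Pi.single 0 1) y := fun y => by
    rw [form_single_zero]
    exact dvd_mul_right _ _
  have hA : A.Nonempty := by
    refine ⟨Submodule.span EisInt ({r, Pi.single 0 1} ∪ Set.range fun x => th • x),
      Submodule.subset_span (Or.inl (Or.inl rfl)), Submodule.subset_span (Or.inl (Or.inr rfl)),
      fun x => Submodule.subset_span (Or.inr ⟨x, rfl⟩), fun x hx y hy =>
      three_dvd_form_of_mem_span ?_ hx hy⟩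
    have hgen : ∀ x ∈ ({r, Pi.single 0 1} ∪ Set.range fun x => th • x :
        Set (Fin 11 → EisInt)), x = r ∨ ∀ y, (3 : EisInt) ∣ form x y := by
      rintro x ((hx | hx) | ⟨y, hy⟩)
      · exact Or.inl hx
      · exact Or.inr fun y => by rw [hx]; exact h0 y
      · exact Or.inr fun z => by rw [← hy]; exact hth y z
    intro x hx y hy
    rcases hgen x hx with hx | hx
    · rcases hgen y hy with hy | hy
      · rw [hx, hy, hr]
      · exact hsymm _ _ (hy x)
    · exact hx y
  obtain ⟨W, hWA, hmax⟩ := (wellFounded_gt (α := Submodule EisInt (Fin 11 → EisInt))).has_min A hA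
  obtain ⟨hrW, h0W, hthW, hW⟩ := hWA
  refine ⟨W, hrW, h0W, hthW, hW, fun y hy => ?_⟩
  by_contra hyW
  have hle : W ≤ Submodule.span EisInt (W ∪ {y}) := fun x hx => Submodule.subset_span (Or.inl hx)
  refine hmax (Submodule.span EisInt (W ∪ {y})) ⟨hle hrW, hle h0W, fun x => hle (hthW x),
    fun x hx z hz => three_dvd_form_of_mem_span ?_ hx hz⟩ (lt_of_le_of_ne hle fun h => hyW ?_)
  · intro x hx z hz
    rcases hx with hx | hx <;> rcases hz with hz | hz
    · exact hW x hx z hz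
    · rw [Set.mem_singleton_iff.1 hz]
      exact hy x hx
    · rw [Set.mem_singleton_iff.1 hx]
      exact hsymm _ _ (hy z hz)
    · rw [Set.mem_singleton_iff.1 hx, Set.mem_singleton_iff.1 hz]
      exact three_dvd_form_self y
  · rw [h]
    exact Submodule.subset_span (Or.inr rfl)

theorem form_smul_smul_th (x y : Fin 11 → EisInt) : form (th • x) (th • y) = 3 * form x y := by
  rw [form.smul_left, form.smul_right, EisInt.star_th]
  linear_combination (-form x y) * EisInt.th_mul_th

theorem exists_isStdEmbedding {r : Fin 11 → EisInt} (hr : form r r = 3)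
    (hnodal : ∃ y, form r y = th) : ∃ j, IsStdEmbedding r j := by
  obtain ⟨W, hrW, h0W, hthW, hW, hmax⟩ := exists_maximal_sublattice hr
  have h3 := EisInt.three_ne_zero
  have hd : ∀ x y : W, (3 : EisInt) ∣ form.restrict W x y := fun x y => hW x x.2 y y.2
  let k : HermForm W := (form.restrict W).divide h3 (star_ofNat 3) hd
  have hk : ∀ x y : W, 3 * k x y = form x y := (form.restrict W).mul_divide h3 (star_ofNat 3) hd
  have hunim : k.IsUnimodular := by
    intro φ
    let T : (Fin 11 → EisInt) →ₗ[EisInt] W :=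
      LinearMap.codRestrict W (th • LinearMap.id) hthW
    have hT : ∀ x : W, T x = th • x := fun x => rfl
    have hψ : ∀ x : W, ((-th) • (φ ∘ₗ T)) x = 3 * φ x := fun x => by
      rw [LinearMap.smul_apply, LinearMap.comp_apply, hT, map_smul, smul_eq_mul, smul_eq_mul]
      linear_combination (-φ x) * EisInt.th_mul_th
    obtain ⟨y, hy⟩ := exists_form_eq (φ := (-th) • (φ ∘ₗ T))
      (by rw [hψ ⟨_, h0W⟩]; exact dvd_mul_right _ _)
      (fun i => by
        rw [LinearMap.smul_apply, smul_eq_mul]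
        exact (dvd_neg.2 dvd_rfl).mul_right _)
    have hyW : ∀ x : W, form x y = 3 * φ x := fun x => by rw [← hy, hψ]
    refine ⟨⟨y, hmax y fun x hx => ?_⟩, fun x => mul_left_cancel₀ h3 ?_⟩
    · rw [hyW ⟨x, hx⟩]
      exact dvd_mul_right _ _
    · rw [hk, ← hyW]
  have hframe : k.IsFrame (sgn (9 + 1)) th
      (fun i => (⟨th • frameMatrix i, hthW _⟩ : W)) := by
    refine ⟨fun i l => mul_left_cancel₀ h3 ?_, fun x hx => Subtype.ext ?_⟩
    · rw [hk, form_smul_smul_th, form_frameMatrix]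
      split_ifs
      · rw [EisInt.star_th]
        linear_combination (3 * sgn 10 i) * EisInt.th_mul_th
      · rfl
    · refine eq_zero_of_form_frameMatrix fun i => ?_
      have := hk x ⟨th • frameMatrix i, hthW _⟩
      rw [hx i, mul_zero, form.smul_right] at this
      exact (mul_eq_zero.1 this.symm).resolve_left (by rw [EisInt.star_th]; decide)
  have hkr : k ⟨r, hrW⟩ ⟨r, hrW⟩ = 1 := mul_left_cancel₀ h3 (by rw [hk, hr, mul_one])
  obtain ⟨b, hb, hb0⟩ := hunim.exists_orthonormal_extending EisInt.th_ne_zero hframe hkr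
  let c : W →ₗ[EisInt] (Fin 11 → EisInt) :=
    LinearMap.pi fun i => sgn 10 i • k.pairing (b i)
  have hc : ∀ w i, c w i = sgn 10 i * k w (b i) := fun _ _ => rfl
  let e : (Fin 11 → EisInt) →ₗ[EisInt] W := Fintype.linearCombination EisInt b
  have he : ∀ x, e x = ∑ i, x i • b i := fun x => Fintype.linearCombination_apply _ _ _
  have hec : ∀ w, e (c w) = w := fun w => by
    rw [he]
    exact hb.sum_eq (sgn_mul_self 10) w
  have hce : ∀ x, c (e x) = x := fun x => by
    ext1 i
    rw [hc, he, k.sum_left]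
    simp only [k.smul_left, hb.apply_eq]
    simp only [star_one, mul_one, mul_ite, mul_zero, Finset.sum_ite_eq', Finset.mem_univ, if_true]
    linear_combination x i * sgn_mul_self 10 i
  have hcstd : ∀ v w, std 10 (c v) (c w) = k v w := fun v w => by
    conv_rhs => rw [← hec w, he, k.sum_right]
    rw [StdForm.std_apply]
    refine Finset.sum_congr rfl fun i _ => ?_
    rw [k.smul_right, hc v]
    linear_combination k v (b i) * star (c w i) * sgn_mul_self 10 i
  let T : (Fin 11 → EisInt) →ₗ[EisInt] W := LinearMap.codRestrict W (th • LinearMap.id) hthW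
  have hTW : ∀ x : W, T x = th • x := fun x => rfl
  have hTc : ∀ x, (T x : Fin 11 → EisInt) = th • x := fun x => rfl
  refine ⟨c ∘ₗ T, ⟨fun x y hxy => ?_, fun x y => ?_, ?_, fun x => ⟨e x, ?_⟩,
    fun x hx hxy => ?_, ?_⟩⟩
  · have h1 : T x = T y := by
      rw [← hec (T x), ← hec (T y)]
      exact congrArg e hxy
    have h2 : th • x = th • y := congrArg Subtype.val h1
    exact smul_right_injective _ EisInt.th_ne_zero h2
  · rw [LinearMap.comp_apply, LinearMap.comp_apply, hcstd]
    refine mul_left_cancel₀ h3 ?_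
    rw [hk, hTc, hTc, form_smul_smul_th]
  · rw [LinearMap.comp_apply, hTW ⟨r, hrW⟩, map_smul, ← hb0]
    congr 1
    ext1 i
    rw [hc, hb.apply_eq]
    by_cases hi : i = 0
    · subst hi
      rw [if_pos rfl, Pi.single_eq_same, star_one]
      linear_combination sgn_mul_self 10 0
    · rw [if_neg (Ne.symm hi), mul_zero, Pi.single_eq_of_ne hi]
  · rw [LinearMap.comp_apply, hTW, map_smul, hce]
  · obtain ⟨w, rfl⟩ : ∃ w, x = c w := ⟨e x, (hce x).symm⟩
    have hwy : ∀ y, (3 : EisInt) ∣ form w y := fun y => by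
      obtain ⟨d, hd⟩ := hxy y
      rw [LinearMap.comp_apply, hcstd] at hd
      have h1 := hk w (T y)
      rw [hd, hTc, form.smul_right, EisInt.star_th] at h1
      refine ⟨-d, mul_left_cancel₀ EisInt.th_ne_zero ?_⟩
      linear_combination h1
    have hwi : ∀ i, ∃ z, i ≠ 0 → (w : Fin 11 → EisInt) i = th * z := fun i => by
      by_cases hi : i = 0
      · exact ⟨0, fun h => absurd hi h⟩
      · obtain ⟨z, hz⟩ := th_dvd_of_three_dvd_form hwy hi
        exact ⟨z, fun _ => hz⟩
    choose z hz using hwi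
    set w₀ := (w : Fin 11 → EisInt) 0 with hw₀
    have hw : (w : Fin 11 → EisInt) = w₀ • Pi.single 0 1 + th • Function.update z 0 0 := by
      ext1 i
      by_cases hi : i = 0
      · subst hi; simp [hw₀]
      · simp [hi, hz i hi]
    have hww : std 10 (c w) (c w) = w₀ * star w₀ + form (Function.update z 0 0)
        (Function.update z 0 0) := by
      rw [hcstd]
      refine mul_left_cancel₀ h3 ?_
      rw [hk, hw]
      have h1 : form (Pi.single 0 1) (Function.update z 0 0) = 0 := by
        rw [form_single_zero]
        simp
      have h2 := form.apply_eq_zero_comm h1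
      have h3 : form (Pi.single 0 1) (Pi.single 0 1) = 3 := by
        rw [form_single_zero]
        simp
      rw [form.add_left, form.add_right, form.add_right, form_smul_smul_th]
      simp only [form.smul_left, form.smul_right, h1, h2, h3]
      ring
    have hw₀' : th ∣ w₀ := by
      rw [← EisInt.red_eq_zero_iff] at hx ⊢
      have h1 := EisInt.red_eq_zero_iff.2
        (th_dvd_form (Function.update z 0 0) (Function.update z 0 0))
      rw [hww, map_add, h1, add_zero, map_mul, EisInt.red_star] at hx
      exact mul_self_eq_zero.1 hx
    obtain ⟨d, hd⟩ := hw₀'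
    refine ⟨d • Pi.single 0 1 + Function.update z 0 0, congrArg c (Subtype.ext ?_)⟩
    rw [hTc, hw, hd, smul_add, smul_smul]
  · obtain ⟨y, hy⟩ := hnodal
    have h1 : form y r = -th := by rw [← form.star_apply, hy, EisInt.star_th]
    have h2 : c (T y) 0 = 1 := by
      rw [hc, hb0]
      refine mul_left_cancel₀ h3 ?_
      have h4 : sgn 10 0 = 1 := rfl
      rw [h4, one_mul, hk, hTc, form.smul_left, h1]
      linear_combination -EisInt.th_mul_th
    refine ⟨y, fun h => ?_⟩
    rw [LinearMap.comp_apply, h2, ← EisInt.red_eq_zero_iff, map_one] at h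
    exact one_ne_zero h

end NodalLattice

namespace NodalLattice

open HermForm (sgn)
open EisInt (red th)
open StdForm

namespace IsStdEmbedding

variable {r : Fin 11 → EisInt} {j : (Fin 11 → EisInt) →ₗ[EisInt] (Fin 11 → EisInt)}

theorem redVec_mem_map_iff (hj : IsStdEmbedding r j) (x : Fin 11 → EisInt) :
    redVec 10 x ∈ (LinearMap.range j).map (redVec 10) ↔ x ∈ LinearMap.range j := by
  refine ⟨?_, fun hx => ⟨x, hx, rfl⟩⟩
  rintro ⟨y, hy, hyx⟩
  have h1 : ∀ i, ∃ z, x i - y i = th * z := fun i => by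
    refine EisInt.red_eq_zero_iff.1 ?_
    rw [map_sub, sub_eq_zero]
    exact (congrFun hyx i).symm
  choose z hz using h1
  have h2 : x = y + th • z := by
    ext1 i
    rw [Pi.add_apply, Pi.smul_apply, smul_eq_mul, ← hz, add_sub_cancel]
  rw [h2]
  exact add_mem hy (hj.smul_mem z)

theorem isMaxIsotropic (hj : IsStdEmbedding r j) :
    TernaryForm.IsMaxIsotropic (stdRed 10) ((LinearMap.range j).map (redVec 10)) where
  isotropic := by
    rintro _ ⟨_, ⟨x, rfl⟩, rfl⟩ _ ⟨_, ⟨y, rfl⟩, rfl⟩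
    rw [← red_std, hj.std_apply, EisInt.red_eq_zero_iff]
    exact th_dvd_form x y
  maximal := by
    intro x hx h
    obtain ⟨x, rfl⟩ := redVec_surjective 10 x
    rw [← red_std, EisInt.red_eq_zero_iff] at hx
    refine ⟨x, hj.mem_range x hx fun y => ?_, rfl⟩
    rw [← EisInt.red_eq_zero_iff, red_std]
    exact h _ ⟨j y, ⟨y, rfl⟩, rfl⟩

theorem exists_pairing_ne_zero (hj : IsStdEmbedding r j) :
    ∃ x ∈ (LinearMap.range j).map (redVec 10), stdRed 10 x (Pi.single 0 1) ≠ 0 := by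
  obtain ⟨y, hy⟩ := hj.exists_apply_zero
  refine ⟨_, ⟨j y, ⟨y, rfl⟩, rfl⟩, ?_⟩
  rw [← redVec_single, ← red_std, std_single, Ne, EisInt.red_eq_zero_iff]
  rwa [show sgn 10 0 = 1 from rfl, one_mul]

end IsStdEmbedding

/-- Nodal roots are equivalent under the isometry group. -/
theorem exists_isometry {r s : Fin 11 → EisInt} (hr : form r r = 3) (hs : form s s = 3)
    (hrn : ∃ y, form r y = th) (hsn : ∃ y, form s y = th) :
    ∃ γ : (Fin 11 → EisInt) ≃ₗ[EisInt] (Fin 11 → EisInt),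
      (∀ x y, form (γ x) (γ y) = form x y) ∧ γ r = s := by
  obtain ⟨j, hj⟩ := exists_isStdEmbedding hr hrn
  obtain ⟨k, hk⟩ := exists_isStdEmbedding hs hsn
  have huu : stdRed 10 (Pi.single 0 1) (Pi.single 0 1) = 1 := by
    rw [← redVec_single, ← red_std, std_single]
    simp [show sgn 10 0 = 1 from rfl]
  obtain ⟨g, ⟨G, hG, hG0, hGg⟩, hg⟩ := isReflectionGroup_liftable.exists_apply_mem_iff
    (stdRed_isSymm 10) (stdRed_nondegenerate 10) huu hj.isMaxIsotropic hk.isMaxIsotropic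
    hj.exists_pairing_ne_zero hk.exists_pairing_ne_zero
  have hGmem : ∀ x, G x ∈ LinearMap.range k ↔ x ∈ LinearMap.range j := fun x => by
    rw [← hk.redVec_mem_map_iff, hGg, hg, hj.redVec_mem_map_iff]
  have hmap : (LinearMap.range j).map G.toLinearMap = LinearMap.range k := by
    refine le_antisymm ?_ fun y hy => ⟨G.symm y, ?_, G.apply_symm_apply y⟩
    · rintro _ ⟨x, hx, rfl⟩
      exact (hGmem x).2 hx
    · rw [SetLike.mem_coe, ← hGmem, G.apply_symm_apply]
      exact hy
  let γ : (Fin 11 → EisInt) ≃ₗ[EisInt] (Fin 11 → EisInt) :=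
    (LinearEquiv.ofInjective j hj.injective).trans
      ((G.submoduleMap (LinearMap.range j)).trans
        ((LinearEquiv.ofEq _ _ hmap).trans (LinearEquiv.ofInjective k hk.injective).symm))
  have hγ : ∀ x, k (γ x) = G (j x) := fun x =>
    congrArg Subtype.val ((LinearEquiv.ofInjective k hk.injective).apply_symm_apply _)
  refine ⟨γ, fun x y => ?_, hk.injective ?_⟩
  · rw [← hk.std_apply, hγ, hγ, hG, hj.std_apply]
  · rw [hγ, hj.apply_root, hk.apply_root, map_smul, hG0]

end NodalLattice

namespace EisInt

theorem omega_sq : ω * ω = -1 - ω := by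
  have h : (Real.sqrt 3) * Real.sqrt 3 = 3 := Real.mul_self_sqrt (by norm_num)
  apply Complex.ext
  · simp only [ω, Complex.mul_re, Complex.sub_re, Complex.neg_re, Complex.one_re]
    linear_combination (-1 / 4) * h
  · simp only [ω, Complex.mul_im, Complex.sub_im, Complex.neg_im, Complex.one_im]
    ring

theorem conj_omega : (starRingEnd ℂ) ω = -1 - ω := by
  apply Complex.ext
  · simp only [ω, Complex.conj_re, Complex.sub_re, Complex.neg_re, Complex.one_re]
    norm_num
  · simp only [ω, Complex.conj_im, Complex.sub_im, Complex.neg_im, Complex.one_im]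
    ring

/-- The embedding into the complex numbers. -/
def toComplex : EisInt →+* ℂ where
  toFun z := z.re + z.im * ω
  map_one' := by
    rw [QuadraticAlgebra.re_one, QuadraticAlgebra.im_one]
    push_cast
    ring
  map_zero' := by
    rw [QuadraticAlgebra.re_zero, QuadraticAlgebra.im_zero]
    push_cast
    ring
  map_add' x y := by
    simp only [QuadraticAlgebra.re_add, QuadraticAlgebra.im_add]
    push_cast
    ring
  map_mul' x y := by
    simp only [QuadraticAlgebra.re_mul, QuadraticAlgebra.im_mul]
    push_cast
    linear_combination (-(x.im : ℂ) * y.im) * omega_sq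

theorem toComplex_apply (z : EisInt) : toComplex z = z.re + z.im * ω := rfl

theorem toComplex_star (z : EisInt) : toComplex (star z) = (starRingEnd ℂ) (toComplex z) := by
  rw [toComplex_apply, toComplex_apply, star_re, star_im, map_add, map_mul, conj_omega,
    map_intCast, map_intCast]
  push_cast
  ring

theorem toComplex_th : toComplex th = θ := by
  rw [toComplex_apply, θ, conj_omega]
  simp only [th]
  push_cast
  ring

theorem toComplex_injective : Function.Injective toComplex := by
  rw [injective_iff_map_eq_zero]
  intro z hz
  have h1 : toComplex (z * star z) = 0 := by rw [map_mul, hz, zero_mul]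
  rw [mul_star_self, map_intCast] at h1
  exact norm_eq_zero (by exact_mod_cast h1)

theorem range_toComplex : toComplex.range = Eis := by
  apply le_antisymm
  · rintro _ ⟨z, rfl⟩
    rw [toComplex_apply]
    exact add_mem (intCast_mem _ _)
      (mul_mem (intCast_mem _ _) (Subring.subset_closure (Set.mem_singleton ω)))
  · refine Subring.closure_le.2 (Set.singleton_subset_iff.2 ⟨⟨0, 1⟩, ?_⟩)
    simp [toComplex_apply]

/-- The computable model is isomorphic to the ring of Eisenstein integers. -/
def equivEis : EisInt ≃+* Eis :=
  (RingEquiv.ofLeftInverse (Function.leftInverse_invFun toComplex_injective)).trans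
    (RingEquiv.subringCongr range_toComplex)

theorem coe_equivEis (z : EisInt) : (equivEis z : ℂ) = toComplex z := rfl

theorem toComplex_equivEis_symm (z : Eis) : toComplex (equivEis.symm z) = z := by
  rw [← coe_equivEis, RingEquiv.apply_symm_apply]

end EisInt

namespace NodalLattice

open EisInt (th toComplex equivEis)

theorem toComplex_gram (i j : Fin 11) : toComplex (gram i j) = Lam11 i j := by
  have h0 : toComplex 3 = 3 := map_ofNat _ 3
  have hB : ∀ a b, toComplex (gramB a b) = Bmat a b := fun a b => by
    fin_cases a <;> fin_cases b <;> simp [gramB, Bmat, EisInt.toComplex_th, h0]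
  have hC : ∀ a b, toComplex (gramC a b) = Cmat a b := fun a b => by
    fin_cases a <;> fin_cases b <;> simp [gramC, Cmat, EisInt.toComplex_th]
  simp only [gram, blocks, Lam11, Lam10, Matrix.of_apply, Nat.sub_sub]
  split_ifs <;> first | omega | simp only [hB, hC, map_zero]

/-- The coordinatewise isomorphism between the two models of the lattice. -/
def model (x : Fin 11 → Eis) : Fin 11 → EisInt := fun i => equivEis.symm (x i)

theorem hermE_eq (x y : Fin 11 → Eis) : hermE x y = toComplex (form (model x) (model y)) := by
  rw [hermE, form_apply, map_sum]
  refine Finset.sum_congr rfl fun i _ => ?_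
  rw [map_sum]
  refine Finset.sum_congr rfl fun j _ => ?_
  rw [map_mul, map_mul, EisInt.toComplex_star, toComplex_gram, model, model,
    EisInt.toComplex_equivEis_symm, EisInt.toComplex_equivEis_symm]

/-- Transport of an automorphism between the two models of the lattice. -/
def transport (γ : (Fin 11 → EisInt) ≃ₗ[EisInt] (Fin 11 → EisInt)) :
    (Fin 11 → Eis) ≃ₗ[Eis] (Fin 11 → Eis) where
  toFun x i := equivEis (γ (model x) i)
  invFun x i := equivEis (γ.symm (model x) i)
  map_add' x y := funext fun i => by
    have : model (x + y) = model x + model y := funext fun i => map_add _ _ _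
    rw [this, map_add, Pi.add_apply, map_add, Pi.add_apply]
  map_smul' c x := funext fun i => by
    have : model (c • x) = equivEis.symm c • model x := funext fun i => map_mul _ _ _
    rw [this, map_smul, Pi.smul_apply, smul_eq_mul, map_mul, RingEquiv.apply_symm_apply]
    rfl
  left_inv x := funext fun i => by
    have : model (fun i => equivEis (γ (model x) i)) = γ (model x) :=
      funext fun i => equivEis.symm_apply_apply _
    simp only [this, γ.symm_apply_apply]
    exact equivEis.apply_symm_apply _
  right_inv x := funext fun i => by
    have : model (fun i => equivEis (γ.symm (model x) i)) = γ.symm (model x) :=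
      funext fun i => equivEis.symm_apply_apply _
    simp only [this, γ.apply_symm_apply]
    exact equivEis.apply_symm_apply _

theorem model_transport (γ : (Fin 11 → EisInt) ≃ₗ[EisInt] (Fin 11 → EisInt))
    (x : Fin 11 → Eis) : model (transport γ x) = γ (model x) :=
  funext fun _ => equivEis.symm_apply_apply _

theorem form_model_self {r : Fin 11 → Eis} (hr : hermE r r = 3) : form (model r) (model r) = 3 := by
  apply EisInt.toComplex_injective
  rw [← hermE_eq, hr]
  exact (map_ofNat toComplex 3).symm

theorem exists_form_model_eq_th {r : Fin 11 → Eis} (hr : innerSetE r = thetaEis) :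
    ∃ y, form (model r) y = th := by
  obtain ⟨y, hy⟩ : θ ∈ innerSetE r := by
    rw [hr]
    exact ⟨1, by simp⟩
  refine ⟨model y, EisInt.toComplex_injective ?_⟩
  rw [← hermE_eq, ← hy, EisInt.toComplex_th]

end NodalLattice

/-- Any two nodal roots of `Λ` are equivalent under the isometry group
`Γ` of `Λ`. -/
theorem stmt_9 :
    ∀ r s : Fin 11 → Eis, hermE r r = 3 → hermE s s = 3 →
      innerSetE r = thetaEis → innerSetE s = thetaEis →
      ∃ γ : (Fin 11 → Eis) ≃ₗ[Eis] (Fin 11 → Eis),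
        (∀ x y : Fin 11 → Eis, hermE (γ x) (γ y) = hermE x y) ∧ γ r = s := by
  intro r s hr hs hrn hsn
  obtain ⟨γ, hγ, hγr⟩ := NodalLattice.exists_isometry
    (NodalLattice.form_model_self hr) (NodalLattice.form_model_self hs)
    (NodalLattice.exists_form_model_eq_th hrn) (NodalLattice.exists_form_model_eq_th hsn)
  refine ⟨NodalLattice.transport γ, fun x y => ?_, ?_⟩
  · rw [NodalLattice.hermE_eq, NodalLattice.model_transport, NodalLattice.model_transport, hγ,
      ← NodalLattice.hermE_eq]
  · have h : NodalLattice.model (NodalLattice.transport γ r) = NodalLattice.model s := by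
      rw [NodalLattice.model_transport, hγr]
    exact funext fun i => EisInt.equivEis.symm.injective (congrFun h i)
end
end

section
/- The group of ℰ-linear automorphisms of Λ₁₀ preserving its Hermitian form acts transitively on the set of ℰ-submodules M ⊆ Λ₁₀ of index 3 (i.e., with quotient Λ₁₀/M of order 3 as an abelian group): for any two such submodules M, M' there is a form-preserving ℰ-linear automorphism of Λ₁₀ carrying M onto M'. -/
noncomputable section

set_option synthInstance.maxHeartbeats 1000000
set_option maxHeartbeats 1000000

/-- The Hermitian form of `Λ₁₀ = ℰ¹⁰`. -/
def herm10E (x y : Fin 10 → Eis) : ℂ :=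
  ∑ i : Fin 10, ∑ j : Fin 10, Lam10 i j * (x i : ℂ) * (starRingEnd ℂ) ((y j : ℂ))

namespace Eisenstein

lemma omega_sq : ω * ω = -1 - ω := by
  have h : Real.sqrt 3 * Real.sqrt 3 = 3 := Real.mul_self_sqrt (by norm_num)
  apply Complex.ext
  · simp only [ω, Complex.mul_re, Complex.sub_re, Complex.neg_re, Complex.one_re]
    linarith
  · simp only [ω, Complex.mul_im, Complex.sub_im, Complex.neg_im, Complex.one_im]
    ring

lemma conj_omega : (starRingEnd ℂ) ω = -1 - ω := by
  apply Complex.ext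
  · simp only [ω, Complex.conj_re, Complex.sub_re, Complex.neg_re, Complex.one_re]
    norm_num
  · simp only [ω, Complex.conj_im, Complex.sub_im, Complex.neg_im, Complex.one_im]
    ring

lemma theta_eq : θ = 1 + 2 * ω := by
  rw [θ, conj_omega]; ring

/-- `ω` as an element of `ℰ`. -/
def om : Eis := ⟨ω, Subring.subset_closure rfl⟩

/-- `θ` as an element of `ℰ`. -/
def th : Eis := 1 + 2 * om

lemma coe_om : (om : ℂ) = ω := rfl

lemma coe_th : (th : ℂ) = θ := by
  rw [theta_eq]; rfl

lemma om_sq : om * om = -1 - om := Subtype.ext omega_sq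

lemma exists_int_add_int_mul_om (x : Eis) : ∃ p : ℤ × ℤ, x = p.1 + p.2 * om := by
  obtain ⟨x, hx⟩ := x
  induction hx using Subring.closure_induction with
  | mem x hx => exact ⟨(0, 1), Subtype.ext (by simpa [om] using hx)⟩
  | zero => exact ⟨(0, 0), Subtype.ext (by simp)⟩
  | one => exact ⟨(1, 0), Subtype.ext (by simp)⟩
  | add x y hx hy ihx ihy =>
    obtain ⟨p, hp⟩ := ihx
    obtain ⟨q, hq⟩ := ihy
    refine ⟨(p.1 + q.1, p.2 + q.2), ?_⟩
    change (⟨x, hx⟩ : Eis) + ⟨y, hy⟩ = _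
    rw [hp, hq]; push_cast; ring
  | neg x hx ihx =>
    obtain ⟨p, hp⟩ := ihx
    refine ⟨(-p.1, -p.2), ?_⟩
    change -(⟨x, hx⟩ : Eis) = _
    rw [hp]; push_cast; ring
  | mul x y hx hy ihx ihy =>
    obtain ⟨p, hp⟩ := ihx
    obtain ⟨q, hq⟩ := ihy
    refine ⟨(p.1 * q.1 - p.2 * q.2, p.1 * q.2 + p.2 * q.1 - p.2 * q.2), ?_⟩
    change (⟨x, hx⟩ : Eis) * ⟨y, hy⟩ = _
    rw [hp, hq]; push_cast
    linear_combination ((p.2 : Eis) * q.2) * om_sq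

lemma int_add_int_mul_om_injective {a b c d : ℤ}
    (h : (a + b * om : Eis) = c + d * om) : a = c ∧ b = d := by
  have h' : (a + b * ω : ℂ) = c + d * ω := by
    simpa [coe_om] using congrArg (fun x : Eis => (x : ℂ)) h
  have him := congrArg Complex.im h'
  have hre := congrArg Complex.re h'
  simp [ω] at him hre
  have hb : b = d := by tauto
  subst hb
  simp at hre
  exact ⟨hre, rfl⟩

/-- The coordinates of an Eisenstein integer in the basis `1, ω`. -/
def coords (x : Eis) : ℤ × ℤ := (exists_int_add_int_mul_om x).choose

lemma coords_spec (x : Eis) : x = (coords x).1 + (coords x).2 * om :=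
  (exists_int_add_int_mul_om x).choose_spec

lemma coords_eq (a b : ℤ) : coords (a + b * om) = (a, b) := by
  have h := int_add_int_mul_om_injective (coords_spec (a + b * om))
  exact Prod.ext h.1.symm h.2.symm

/-- The value at `a + b ω` of the reduction modulo `θ`. -/
def redFun (x : Eis) : ZMod 3 := (coords x).1 + (coords x).2

lemma redFun_eq (a b : ℤ) : redFun (a + b * om) = a + b := by
  rw [redFun, coords_eq]

lemma three_eq_zero : (3 : ZMod 3) = 0 := rfl

/-- Reduction modulo `θ`. -/
def red : Eis →+* ZMod 3 where
  toFun := redFun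
  map_one' := by simpa using redFun_eq 1 0
  map_zero' := by simpa using redFun_eq 0 0
  map_add' x y := by
    obtain ⟨⟨a, b⟩, rfl⟩ := exists_int_add_int_mul_om x
    obtain ⟨⟨c, d⟩, rfl⟩ := exists_int_add_int_mul_om y
    have h : (a + b * om + (c + d * om) : Eis) = ((a + c : ℤ) : Eis) + ((b + d : ℤ) : Eis) * om := by
      push_cast; ring
    simp only
    rw [h, redFun_eq, redFun_eq, redFun_eq]
    push_cast; ring
  map_mul' x y := by
    obtain ⟨⟨a, b⟩, rfl⟩ := exists_int_add_int_mul_om x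
    obtain ⟨⟨c, d⟩, rfl⟩ := exists_int_add_int_mul_om y
    have h : ((a + b * om) * (c + d * om) : Eis) =
        ((a * c - b * d : ℤ) : Eis) + ((a * d + b * c - b * d : ℤ) : Eis) * om := by
      push_cast
      linear_combination ((b : Eis) * d) * om_sq
    simp only
    rw [h, redFun_eq, redFun_eq, redFun_eq]
    push_cast
    linear_combination (-b * d : ZMod 3) * three_eq_zero

lemma red_om : red om = 1 := by
  have h := redFun_eq 0 1
  simp only [Int.cast_zero, Int.cast_one, one_mul, zero_add] at h
  exact h

lemma red_th : red th = 0 := by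
  rw [th, map_add, map_mul, red_om, map_one, map_ofNat]; rfl

/-- Complex conjugation on `ℰ`. -/
def cj : Eis →+* Eis :=
  ((starRingEnd ℂ).comp Eis.subtype).codRestrict Eis fun x => by
    obtain ⟨⟨a, b⟩, rfl⟩ := exists_int_add_int_mul_om x
    have h : ((starRingEnd ℂ).comp Eis.subtype) (a + b * om) = ((a + b * (-1 - om) : Eis) : ℂ) := by
      simp [coe_om, conj_omega]
    rw [h]
    exact Subtype.property _

lemma coe_cj (x : Eis) : (cj x : ℂ) = (starRingEnd ℂ) (x : ℂ) := rfl

lemma cj_om : cj om = -1 - om := Subtype.ext conj_omega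

lemma cj_th : cj th = -th := by
  rw [th, map_add, map_mul, cj_om, map_one, map_ofNat]; ring

lemma cj_cj (x : Eis) : cj (cj x) = x := Subtype.ext (Complex.conj_conj _)

lemma red_cj (x : Eis) : red (cj x) = red x := by
  obtain ⟨⟨a, b⟩, rfl⟩ := exists_int_add_int_mul_om x
  simp only [map_add, map_mul, map_intCast, cj_om, red_om, map_sub, map_neg, map_one]
  linear_combination (-b : ZMod 3) * three_eq_zero

lemma exists_eq_int_mul_th_of_cj_eq_neg {x : Eis} (h : cj x = -x) : ∃ n : ℤ, x = n * th := by
  obtain ⟨⟨a, b⟩, rfl⟩ := exists_int_add_int_mul_om x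
  have h' : (((a - b : ℤ) : Eis) + ((-b : ℤ) : Eis) * om) = ((-a : ℤ) : Eis) + ((-b : ℤ) : Eis) * om := by
    simp only [map_add, map_mul, map_intCast, cj_om] at h
    push_cast
    linear_combination h
  have hb : b = 2 * a := by linarith [(int_add_int_mul_om_injective h').1]
  refine ⟨a, ?_⟩
  simp only [hb, th]
  push_cast
  ring

/-- The skew-Hermitian form `θ⁻¹⟨x, y⟩` on `ℰ¹⁰`, which is unimodular. -/
def skew (x y : Fin 10 → Eis) : Eis :=
  -th * (x 0 * cj (y 0) + x 1 * cj (y 1) + x 2 * cj (y 2) + x 3 * cj (y 3)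
      + x 4 * cj (y 4) + x 5 * cj (y 5) + x 6 * cj (y 6) + x 7 * cj (y 7))
    + (x 0 * cj (y 1) - x 1 * cj (y 0)) + (x 1 * cj (y 2) - x 2 * cj (y 1))
    + (x 2 * cj (y 3) - x 3 * cj (y 2)) + (x 4 * cj (y 5) - x 5 * cj (y 4))
    + (x 5 * cj (y 6) - x 6 * cj (y 5)) + (x 6 * cj (y 7) - x 7 * cj (y 6))
    + (x 8 * cj (y 9) - x 9 * cj (y 8))

lemma theta_sq : θ * θ = -3 := by
  rw [theta_eq]
  linear_combination 4 * omega_sq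

lemma herm10E_eq (x y : Fin 10 → Eis) : herm10E x y = θ * (skew x y : ℂ) := by
  simp only [herm10E, Lam10, Bmat, Cmat, Fin.sum_univ_succ, skew, Matrix.of_apply]
  simp [coe_cj, coe_th, Fin.succ]
  linear_combination ((x 0 : ℂ) * (starRingEnd ℂ) (y 0 : ℂ) + x 1 * (starRingEnd ℂ) (y 1 : ℂ)
    + x 2 * (starRingEnd ℂ) (y 2 : ℂ) + x 3 * (starRingEnd ℂ) (y 3 : ℂ)
    + x 4 * (starRingEnd ℂ) (y 4 : ℂ) + x 5 * (starRingEnd ℂ) (y 5 : ℂ)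
    + x 6 * (starRingEnd ℂ) (y 6 : ℂ) + x 7 * (starRingEnd ℂ) (y 7 : ℂ)) * theta_sq

lemma skew_add_smul_left (x y r : Fin 10 → Eis) (a : Eis) :
    skew (x + a • r) y = skew x y + a * skew r y := by
  simp only [skew, Pi.add_apply, Pi.smul_apply, smul_eq_mul]
  ring

lemma skew_swap (x y : Fin 10 → Eis) : skew y x = -cj (skew x y) := by
  simp only [skew, map_add, map_sub, map_mul, map_neg, cj_cj, cj_th]
  ring

lemma skew_add_smul_right (x y r : Fin 10 → Eis) (b : Eis) :
    skew x (y + b • r) = skew x y + cj b * skew x r := by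
  simp only [skew, Pi.add_apply, Pi.smul_apply, smul_eq_mul, map_add, map_mul]
  ring

/-- The symplectic form on `𝔽₃¹⁰` induced by `skew`. -/
def sympl (x y : Fin 10 → ZMod 3) : ZMod 3 :=
  (x 0 * y 1 - x 1 * y 0) + (x 1 * y 2 - x 2 * y 1) + (x 2 * y 3 - x 3 * y 2)
    + (x 4 * y 5 - x 5 * y 4) + (x 5 * y 6 - x 6 * y 5) + (x 6 * y 7 - x 7 * y 6)
    + (x 8 * y 9 - x 9 * y 8)

lemma red_skew (x y : Fin 10 → Eis) : red (skew x y) = sympl (red ∘ x) (red ∘ y) := by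
  simp only [skew, sympl, map_add, map_sub, map_mul, map_neg, red_th, red_cj, Function.comp_apply]
  ring

/-- The map `x ↦ x + c s(x, r) r`. -/
def transvection (r : Fin 10 → Eis) (c : Eis) : (Fin 10 → Eis) →ₗ[Eis] (Fin 10 → Eis) where
  toFun x := x + (c * skew x r) • r
  map_add' x y := by
    have h := skew_add_smul_left x r y 1
    rw [one_smul, one_mul] at h
    rw [h, mul_add, add_smul]
    abel
  map_smul' a x := by
    have h := skew_add_smul_left 0 r x a
    have h0 : skew 0 r = 0 := by simp [skew]
    rw [zero_add, h0, zero_add] at h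
    rw [h, RingHom.id_apply, smul_add, smul_smul]
    congr 2
    ring

lemma transvection_apply (r x : Fin 10 → Eis) (c : Eis) :
    transvection r c x = x + (c * skew x r) • r := rfl

lemma transvection_transvection {r : Fin 10 → Eis} (hr : skew r r = -th) {c d : Eis}
    (h : c + d - c * d * th = 0) (x : Fin 10 → Eis) :
    transvection r d (transvection r c x) = x := by
  rw [transvection_apply, transvection_apply, skew_add_smul_left, hr, add_assoc, ← add_smul]
  have h0 : c * skew x r + d * (skew x r + c * skew x r * -th) = 0 := by
    linear_combination (skew x r) * h
  rw [h0, zero_smul, add_zero]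

lemma skew_transvection {r : Fin 10 → Eis} (hr : skew r r = -th) {c : Eis}
    (h : cj c - c - c * cj c * th = 0) (x y : Fin 10 → Eis) :
    skew (transvection r c x) (transvection r c y) = skew x y := by
  rw [transvection_apply, transvection_apply, skew_add_smul_left, skew_add_smul_right,
    skew_add_smul_right, hr, skew_swap y r, map_mul]
  linear_combination (skew x r * cj (skew y r)) * h

/-- The automorphism group of the lattice. -/
def isometries : Subgroup ((Fin 10 → Eis) ≃ₗ[Eis] (Fin 10 → Eis)) where
  carrier := {g | ∀ x y, skew (g x) (g y) = skew x y}
  one_mem' _ _ := rfl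
  mul_mem' {g h} hg hh x y := (hg (h x) (h y)).trans (hh x y)
  inv_mem' {g} hg x y := by
    have h := hg (g.symm x) (g.symm y)
    rw [g.apply_symm_apply, g.apply_symm_apply] at h
    exact h.symm

lemma exists_isometry_transvection {r : Fin 10 → Eis} (hr : skew r r = -th) (ε : ZMod 3)
    (hε : ε ≠ 0) : ∃ g ∈ isometries, ∀ x : Fin 10 → Eis,
      red ∘ g x = red ∘ x + (ε * red (skew x r)) • (red ∘ r) := by
  have key : ∀ c d : Eis, c + d - c * d * th = 0 → cj c - c - c * cj c * th = 0 → red c = ε →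
      ∃ g ∈ isometries, ∀ x : Fin 10 → Eis,
        red ∘ g x = red ∘ x + (ε * red (skew x r)) • (red ∘ r) := by
    intro c d h h' hc
    have h'' : d + c - d * c * th = 0 := by linear_combination h
    refine ⟨LinearEquiv.ofLinearMap (transvection r c) (transvection r d)
      (LinearMap.ext fun x => transvection_transvection hr h'' x)
      (LinearMap.ext fun x => transvection_transvection hr h x),
      fun x y => skew_transvection hr h' x y, fun x => ?_⟩
    funext i
    simp [transvection_apply, hc]
  have h1 : (-1 - om) + -om - (-1 - om) * -om * th = 0 := by
    rw [th]; linear_combination (-1 - 2 * om) * om_sq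
  have h2 : cj (-1 - om) - (-1 - om) - (-1 - om) * cj (-1 - om) * th = 0 := by
    simp only [map_sub, map_neg, map_one, cj_om, th]
    linear_combination (1 + 2 * om) * om_sq
  have h3 : cj (-om) - -om - -om * cj (-om) * th = 0 := by
    simp only [map_neg, cj_om, th]
    linear_combination (1 + 2 * om) * om_sq
  have h4 : -om + (-1 - om) - -om * (-1 - om) * th = 0 := by linear_combination h1
  have hcases : ∀ e : ZMod 3, e ≠ 0 → e = 1 ∨ e = -1 := by decide
  rcases hcases ε hε with rfl | rfl
  · exact key _ _ h1 h2 (by rw [map_sub, map_neg, map_one, red_om]; rfl)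
  · exact key _ _ h4 h3 (by rw [map_neg, red_om])

lemma exists_root (z : Fin 10 → ZMod 3) (hz : z 9 ≠ 0) :
    ∃ r : Fin 10 → Eis, skew r r = -th ∧ red ∘ r = z := by
  have hcases : ∀ e : ZMod 3, e ≠ 0 → ∃ k : ℤ, k * k = 1 ∧ (k : ZMod 3) = e := by
    intro e he
    have : e = 1 ∨ e = -1 := by revert e; decide
    rcases this with rfl | rfl
    · exact ⟨1, by norm_num, by norm_num⟩
    · exact ⟨-1, by norm_num, by norm_num⟩
  obtain ⟨e, he, hez⟩ := hcases _ hz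
  let w : Fin 10 → Eis := fun i => if i = 8 ∨ i = 9 then 0 else ((z i).val : Eis)
  have hw : cj (skew w w) = -skew w w := by
    conv_rhs => rw [skew_swap, neg_neg]
  obtain ⟨n, hn⟩ := exists_eq_int_mul_th_of_cj_eq_neg hw
  let k : ℤ := e * (-1 - n)
  obtain ⟨m, hm⟩ := ZMod.intCast_surjective (z 8)
  let r : Fin 10 → Eis := fun i =>
    if i = 8 then ((m - k : ℤ) : Eis) + k * om else if i = 9 then (e : Eis) else (z i).val
  refine ⟨r, ?_, ?_⟩
  · have h : skew r r = skew w w + (r 8 * cj (r 9) - r 9 * cj (r 8)) := by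
      simp [skew, r, w]
    have he' : (e : Eis) * e = 1 := by exact_mod_cast he
    rw [h, hn]
    simp [r, k, cj_om]
    rw [th]
    linear_combination (-1 - n : Eis) * (1 + 2 * om) * he'
  · funext i
    by_cases h8 : i = 8
    · subst h8
      simp [r, red_om, hm]
    · by_cases h9 : i = 9
      · subst h9
        simp [r, hez]
      · simp [r, h8, h9]

lemma sympl_sub_self (x y : Fin 10 → ZMod 3) : sympl x (y - x) = sympl x y := by
  simp only [sympl, Pi.sub_apply]
  ring

lemma exists_isometry_of_sympl_ne_zero (v : Fin 10 → Eis) (w : Fin 10 → ZMod 3)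
    (h : sympl (red ∘ v) w ≠ 0) (h9 : w 9 ≠ red (v 9)) :
    ∃ g ∈ isometries, red ∘ g v = w := by
  obtain ⟨r, hr, hrz⟩ := exists_root (w - red ∘ v) (sub_ne_zero.mpr h9)
  obtain ⟨g, hg, hgx⟩ := exists_isometry_transvection hr _ h
  refine ⟨g, hg, ?_⟩
  have hsq : ∀ e : ZMod 3, e ≠ 0 → e * e = 1 := by decide
  rw [hgx, red_skew, hrz, sympl_sub_self, hsq _ h, one_smul, add_sub_cancel]

lemma exists_sympl_eq (c : Fin 10 → ZMod 3) :
    ∃ v : Fin 10 → ZMod 3, ∀ x, sympl x v = ∑ i, x i * c i := by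
  refine ⟨![-c 3 - c 1, c 0, -c 3, c 2 + c 0, -c 7 - c 5, c 4, -c 7, c 6 + c 4, -c 9, c 8],
    fun x => ?_⟩
  simp [sympl, Fin.sum_univ_succ, Fin.succ]
  ring

/-- The vector of `𝔽₃¹⁰` to which all nonzero vectors are moved. -/
def base : Fin 10 → ZMod 3 := Pi.single 8 1

lemma sympl_base (x : Fin 10 → ZMod 3) : sympl x base = -x 9 := by
  simp [sympl, base]

lemma exists_isometry_of_apply_nine_ne_zero (v : Fin 10 → Eis) (h : red (v 9) ≠ 0) :
    ∃ g ∈ isometries, red ∘ g v = base := by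
  apply exists_isometry_of_sympl_ne_zero
  · rw [sympl_base]
    exact neg_ne_zero.mpr h
  · exact h.symm

lemma exists_sympl_ne_zero (x : Fin 10 → ZMod 3) (hx : x ≠ 0) (h9 : x 9 = 0) :
    ∃ u : Fin 10 → ZMod 3, sympl x u ≠ 0 ∧ u 9 ≠ 0 := by
  obtain ⟨i, hi⟩ := Function.ne_iff.mp hx
  have hi9 : i ≠ 9 := by
    rintro rfl
    exact hi h9
  obtain ⟨u, hu⟩ := exists_sympl_eq (Pi.single i 1)
  have hu1 : sympl x u ≠ 0 := by
    rw [hu]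
    simpa [Pi.single_apply] using hi
  by_cases hu9 : u 9 = 0
  · by_cases h8 : x 8 = 0
    · refine ⟨u + Pi.single 9 1, ?_, by simp [hu9]⟩
      simpa [sympl, Pi.single_apply, h8, h9] using hu1
    · refine ⟨Pi.single 9 1, ?_, by simp⟩
      simpa [sympl, Pi.single_apply] using h8
  · exact ⟨u, hu1, hu9⟩

lemma exists_isometry_red_eq_base (v : Fin 10 → Eis) (hv : red ∘ v ≠ 0) :
    ∃ g ∈ isometries, red ∘ g v = base := by
  by_cases h9 : red (v 9) = 0
  · obtain ⟨u, hu, hu9⟩ := exists_sympl_ne_zero _ hv h9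
    obtain ⟨g, hg, hgv⟩ := exists_isometry_of_sympl_ne_zero v u hu (h9.symm ▸ hu9)
    obtain ⟨k, hk, hkv⟩ := exists_isometry_of_apply_nine_ne_zero (g v)
      (by rw [← hgv] at hu9; exact hu9)
    exact ⟨k * g, mul_mem hk hg, hkv⟩
  · exact exists_isometry_of_apply_nine_ne_zero v h9

lemma exists_mem_iff_sum_eq_zero (M : Submodule Eis (Fin 10 → Eis))
    (hM : Nat.card ((Fin 10 → Eis) ⧸ M) = 3) :
    ∃ c : Fin 10 → ZMod 3, c ≠ 0 ∧ ∀ x, x ∈ M ↔ ∑ i, red (x i) * c i = 0 := by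
  have hcube : ∀ t : ZMod 3, t * t * t = 1 → t = 1 := by decide
  have : Fact (Nat.Prime 3) := ⟨Nat.prime_three⟩
  have := isAddCyclic_of_prime_card hM
  let e : ((Fin 10 → Eis) ⧸ M) ≃+ ZMod 3 :=
    (hM ▸ zmodAddCyclicAddEquiv (G := (Fin 10 → Eis) ⧸ M) inferInstance).symm
  have hone : ∀ z : ZMod 3, e (om • e.symm z) = z * e (om • e.symm 1) := by
    intro z
    let f : ZMod 3 →+ ZMod 3 := e.toAddMonoidHom.comp
      ((DistribSMul.toAddMonoidHom ((Fin 10 → Eis) ⧸ M) om).comp e.symm.toAddMonoidHom)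
    have h := map_nsmul f z.val 1
    rw [nsmul_one, ZMod.natCast_zmod_val, nsmul_eq_mul, ZMod.natCast_zmod_val] at h
    exact h
  have hom3 : om * (om * om) = 1 := by
    linear_combination (om - 1) * om_sq
  have hu : e (om • e.symm 1) = 1 := by
    set u := e (om • e.symm 1) with hu
    have h1 : u * u = e (om • om • e.symm 1) := by
      rw [← hone u, hu, e.symm_apply_apply]
    have h2 : u * u * u = 1 := by
      rw [← hone (u * u), h1, e.symm_apply_apply, smul_smul, smul_smul, mul_assoc, hom3, one_smul,
        e.apply_symm_apply]
    exact hcube u h2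
  have hom : ∀ q : (Fin 10 → Eis) ⧸ M, e (om • q) = e q := by
    intro q
    have h := hone (e q)
    rwa [e.symm_apply_apply, hu, mul_one] at h
  have hsmul : ∀ (a : Eis) (q : (Fin 10 → Eis) ⧸ M), e (a • q) = red a * e q := by
    intro a q
    obtain ⟨⟨m, n⟩, rfl⟩ := exists_int_add_int_mul_om a
    simp only [add_smul, mul_smul, Int.cast_smul_eq_zsmul, map_add, map_zsmul, hom, map_mul,
      map_intCast, red_om, zsmul_eq_mul]
    ring
  let c : Fin 10 → ZMod 3 := fun i => e (M.mkQ (Pi.single i 1))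
  have hsum : ∀ x, e (M.mkQ x) = ∑ i, red (x i) * c i := by
    intro x
    conv_lhs => rw [pi_eq_sum_univ' x]
    rw [map_sum, map_sum]
    refine Finset.sum_congr rfl fun i _ => ?_
    rw [map_smul, hsmul]
  refine ⟨c, ?_, fun x => ?_⟩
  · intro hc
    obtain ⟨x, hx⟩ := M.mkQ_surjective (e.symm 1)
    have h := hsum x
    rw [hx, e.apply_symm_apply, hc] at h
    simp at h
  · rw [← hsum, map_eq_zero_iff e e.injective, Submodule.mkQ_apply,
      Submodule.Quotient.mk_eq_zero]

lemma exists_isometry_mem_iff (M : Submodule Eis (Fin 10 → Eis))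
    (hM : Nat.card ((Fin 10 → Eis) ⧸ M) = 3) :
    ∃ g ∈ isometries, ∀ x, x ∈ M ↔ sympl (red ∘ g x) base = 0 := by
  obtain ⟨c, hc, hx⟩ := exists_mem_iff_sum_eq_zero M hM
  obtain ⟨v, hv⟩ := exists_sympl_eq c
  have hlift : red ∘ (fun i => ((v i).val : Eis)) = v := by
    funext i
    simp
  have hv0 : v ≠ 0 := by
    rintro rfl
    refine hc (funext fun i => ?_)
    have h := hv (Pi.single i 1)
    simpa [sympl, Pi.single_apply] using h.symm
  obtain ⟨g, hg, hgv⟩ := exists_isometry_red_eq_base (fun i => ((v i).val : Eis))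
    (by rwa [hlift])
  refine ⟨g, hg, fun x => ?_⟩
  rw [hx, ← hgv, ← red_skew, hg, red_skew, hlift, hv]
  rfl

end Eisenstein

open Eisenstein in
/-- The isometry group of `Λ₁₀` acts transitively on the `ℰ`-submodules
of index 3 (those whose quotient has order 3 as an abelian group). -/
theorem stmt_11 :
    ∀ M M' : Submodule Eis (Fin 10 → Eis),
      Nat.card ((Fin 10 → Eis) ⧸ M) = 3 →
      Nat.card ((Fin 10 → Eis) ⧸ M') = 3 →
      ∃ g : (Fin 10 → Eis) ≃ₗ[Eis] (Fin 10 → Eis),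
        (∀ x y : Fin 10 → Eis, herm10E (g x) (g y) = herm10E x y) ∧
        M.map (g : (Fin 10 → Eis) →ₗ[Eis] (Fin 10 → Eis)) = M' := by
  intro M M' hM hM'
  obtain ⟨g, hg, hgM⟩ := exists_isometry_mem_iff M hM
  obtain ⟨g', hg', hgM'⟩ := exists_isometry_mem_iff M' hM'
  refine ⟨g'⁻¹ * g, fun x y => ?_, ?_⟩
  · rw [herm10E_eq, herm10E_eq, mul_mem (inv_mem hg') hg x y]
  · have hmem : ∀ x, (g'⁻¹ * g) x ∈ M' ↔ x ∈ M := by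
      intro x
      have h : g' ((g'⁻¹ * g) x) = g x := g'.apply_symm_apply (g x)
      rw [hgM', hgM, h]
    ext y
    constructor
    · rintro ⟨x, hx, rfl⟩
      exact (hmem x).mpr hx
    · intro hy
      obtain ⟨x, rfl⟩ := (g'⁻¹ * g).surjective y
      exact ⟨x, (hmem x).mp hy, rfl⟩
end
end
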